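/- arXiv:2203.09436 — 6 statements merged into one kernel-verified Lean document; each statement's English description precedes it below -/
import Mathlib

section
/- Let F : ℝ^d → ℝ^d be (1/L)-cocoercive with a zero u* (F(u*) = 0). On a probability space, let u_0 ∈ ℝ^d be deterministic and let random vectors evolve by the stochastic Halpern iteration u_k = (1/(k+1)) u_0 + (k/(k+1)) (u_{k-1} − (1/L) F̃(u_{k-1})) for k ≥ 1, where F̃(u_{k-1}) is a random vector. Assume E[F̃(u_0)] = F(u_0), E[‖F(u_0) − F̃(u_0)‖²] ≤ ε²/8, and E[‖F(u_k) − F̃(u_k)‖²] ≤ ε²/k for all k ≥ 1, for a given ε > 0. Then for all k ≥ 1, E[‖F(u_k)‖] ≤ Λ₀/k + Λ₁ ε, where Λ₀ = 76 L ‖u_0 − u*‖ and Λ₁ = 4√(2/3). Consequently, for N = ⌈2Λ₀/ε⌉ one has E[‖F(u_N)‖] ≤ 4ε. -/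
open MeasureTheory
open scoped RealInnerProductSpace

theorem aux_step {E : Type*} [NormedAddCommGroup E] [InnerProductSpace ℝ E]
    (k : ℝ) (hk : 0 < k) (u0 x y g h e : E)
    (hrec : (k + 1) • y = u0 + k • (x - (g + e)))
    (hc : ‖h - g‖ ^ 2 ≤ ⟪h - g, y - x⟫) :
    k * (k + 1) / 2 * ‖h‖ ^ 2 + (k + 1) * ⟪h, y - u0⟫ ≤
      k * (k - 1) / 2 * ‖g‖ ^ 2 + k * ⟪g, x - u0⟫ + (k * (k + 1) / 2 * ‖e‖ ^ 2 - k * ⟪g, e⟫) := by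
  have h1 := congrArg (fun z => ⟪h, z⟫) hrec
  have h2 := congrArg (fun z => ⟪g, z⟫) hrec
  have h3 : 0 ≤ ‖h - g + e‖ ^ 2 := sq_nonneg _
  simp only [← real_inner_self_eq_norm_sq, inner_add_right, inner_sub_right, inner_add_left,
    inner_sub_left, real_inner_smul_right] at h1 h2 h3 hc ⊢
  rw [real_inner_comm h g] at *
  rw [real_inner_comm e h] at *
  rw [real_inner_comm e g] at *
  have hkk : 0 < k * (k + 1) := by positivity
  have hc' := mul_le_mul_of_nonneg_left hc hkk.le
  have h3' := mul_le_mul_of_nonneg_left h3 hkk.le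
  linear_combination hc' + h3' / 2 + (k + 1) * h1 - k * h2

theorem aux_path {E : Type*} [NormedAddCommGroup E] [InnerProductSpace ℝ E]
    (u g e : ℕ → E)
    (hrec : ∀ k : ℕ, ((k : ℝ) + 2) • u (k+1) = u 0 + ((k : ℝ) + 1) • (u k - (g k + e k)))
    (hc : ∀ k, ‖g (k+1) - g k‖ ^ 2 ≤ ⟪g (k+1) - g k, u (k+1) - u k⟫) (k : ℕ) :
    (k : ℝ) * (k + 1) / 2 * ‖g k‖ ^ 2 + (k + 1) * ⟪g k, u k - u 0⟫ ≤
      ∑ i ∈ Finset.range k, (((i : ℝ) + 1) * (i + 2) / 2 * ‖e i‖ ^ 2 - (i + 1) * ⟪g i, e i⟫) := by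
  induction k with
  | zero => simp
  | succ k ih =>
    rw [Finset.sum_range_succ]
    have := aux_step ((k : ℝ) + 1) (by positivity) (u 0) (u k) (u (k+1)) (g k) (g (k+1)) (e k)
      (by rw [← hrec]; congr 1; ring) (hc k)
    push_cast
    linear_combination ih + this

theorem aux_core {E Ω : Type*} [NormedAddCommGroup E] [InnerProductSpace ℝ E]
    [MeasurableSpace Ω] (μ : Measure Ω) [IsProbabilityMeasure μ]
    (ε : ℝ) (hε : 0 < ε) (u g e : ℕ → Ω → E) (us u0 g0 : E)
    (hu0 : ∀ ω, u 0 ω = u0) (hg0 : ∀ ω, g 0 ω = g0)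
    (hrec : ∀ (k : ℕ) ω,
      ((k : ℝ) + 2) • u (k+1) ω = u 0 ω + ((k : ℝ) + 1) • (u k ω - (g k ω + e k ω)))
    (hc : ∀ k ω, ‖g (k+1) ω - g k ω‖ ^ 2 ≤ ⟪g (k+1) ω - g k ω, u (k+1) ω - u k ω⟫)
    (hs : ∀ k ω, ‖g k ω‖ ^ 2 ≤ ⟪g k ω, u k ω - us⟫)
    (hg : ∀ k, MemLp (g k) 2 μ) (he : ∀ k, MemLp (e k) 2 μ)
    (he0 : ∫ ω, ⟪g 0 ω, e 0 ω⟫ ∂μ = 0)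
    (hv0 : ∫ ω, ‖e 0 ω‖ ^ 2 ∂μ ≤ ε ^ 2 / 8)
    (hv : ∀ k : ℕ, 1 ≤ k → ∫ ω, ‖e k ω‖ ^ 2 ∂μ ≤ ε ^ 2 / k) (k : ℕ) (hk : 1 ≤ k) :
    ∫ ω, ‖g k ω‖ ∂μ ≤ 76 * ‖u0 - us‖ / k + 3 * ε := by
  set D := ‖u0 - us‖ with hD
  have hD0 : 0 ≤ D := norm_nonneg _
  have ig2 : ∀ k, Integrable (fun ω => ‖g k ω‖ ^ 2) μ := fun k => (hg k).integrable_norm_pow (by norm_num)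
  have ie2 : ∀ k, Integrable (fun ω => ‖e k ω‖ ^ 2) μ := fun k => (he k).integrable_norm_pow (by norm_num)
  have ig : ∀ k, Integrable (fun ω => ‖g k ω‖) μ := fun k => ((hg k).integrable (by norm_num)).norm
  have ige : ∀ k, Integrable (fun ω => ⟪g k ω, e k ω⟫) μ := fun k => by
    refine ((ig2 k).add (ie2 k)).mono' ((hg k).1.inner (he k).1) (Filter.Eventually.of_forall fun ω => ?_)
    have := norm_inner_le_norm (𝕜 := ℝ) (g k ω) (e k ω)
    simp only [Pi.add_apply]
    nlinarith [sq_nonneg (‖g k ω‖ - ‖e k ω‖), sq_nonneg (‖g k ω‖), sq_nonneg (‖e k ω‖)]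
  have path : ∀ (k : ℕ) ω, ((k : ℝ) + 1) * (k + 2) / 2 * ‖g k ω‖ ^ 2 ≤ (k + 1) * D * ‖g k ω‖ +
      ∑ i ∈ Finset.range k,
        (((i : ℝ) + 1) * (i + 2) / 2 * ‖e i ω‖ ^ 2 - (i + 1) * ⟪g i ω, e i ω⟫) := by
    intro k ω
    have h1 := aux_path (fun k => u k ω) (fun k => g k ω) (fun k => e k ω)
      (fun k => hrec k ω) (fun k => hc k ω) k
    rw [hu0] at h1
    have h2 := hs k ω
    have h3 : ⟪g k ω, u0 - us⟫ ≤ ‖g k ω‖ * D := real_inner_le_norm _ _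
    have h4 : ⟪g k ω, u k ω - us⟫ = ⟪g k ω, u k ω - u0⟫ + ⟪g k ω, u0 - us⟫ := by
      rw [← inner_add_right]; congr 1; abel
    have hk1 : (0:ℝ) ≤ k + 1 := by positivity
    have h5 : ((k:ℝ) + 1) * ‖g k ω‖ ^ 2 ≤ (k+1) * (⟪g k ω, u k ω - u0⟫ + ‖g k ω‖ * D) :=
      mul_le_mul_of_nonneg_left (by linarith) hk1
    linear_combination h1 + h5
  have iT : ∀ i : ℕ, Integrable (fun ω => (((i : ℝ) + 1) * (i + 2) / 2 * ‖e i ω‖ ^ 2 - (i + 1) * ⟪g i ω, e i ω⟫)) μ :=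
    fun i => ((ie2 i).const_mul _).sub ((ige i).const_mul _)
  have avg : ∀ k : ℕ, ((k : ℝ) + 1) * (k + 2) / 2 * ∫ ω, ‖g k ω‖ ^ 2 ∂μ ≤
      (k + 1) * D * (∫ ω, ‖g k ω‖ ∂μ) +
      ∑ i ∈ Finset.range k,
        (((i : ℝ) + 1) * (i + 2) / 2 * (∫ ω, ‖e i ω‖ ^ 2 ∂μ) - (i + 1) * ∫ ω, ⟪g i ω, e i ω⟫ ∂μ) := by
    intro k
    have := integral_mono ((ig2 k).const_mul _)
      (((ig k).const_mul _).add (integrable_finsetSum (Finset.range k) fun i _ => iT i)) (path k)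
    simp only [Pi.add_apply] at this
    rw [integral_add ((ig k).const_mul _) (integrable_finsetSum (Finset.range k) fun i _ => iT i),
      integral_finsetSum _ (fun i _ => iT i), integral_const_mul, integral_const_mul] at this
    refine this.trans_eq ?_
    congr 1
    refine Finset.sum_congr rfl fun i _ => ?_
    rw [integral_sub ((ie2 i).const_mul _) ((ige i).const_mul _), integral_const_mul, integral_const_mul]
  -- norm mean bound
  have mean : ∀ (k : ℕ) (b : ℝ), 0 < b → 2 * b * (∫ ω, ‖g k ω‖ ∂μ) ≤ (∫ ω, ‖g k ω‖ ^ 2 ∂μ) + b ^ 2 := by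
    intro k b hb
    have := integral_mono ((ig k).const_mul (2 * b)) ((ig2 k).add (integrable_const (b ^ 2)))
      (fun ω => by simp only [Pi.add_apply]; nlinarith [sq_nonneg (‖g k ω‖ - b)])
    simp only [Pi.add_apply] at this
    rw [integral_add (ig2 k) (integrable_const _), integral_const_mul] at this
    simpa using this
  have cross : ∀ (i : ℕ) (b : ℝ), 1 ≤ i → 0 < b → (∫ ω, ‖g i ω‖ ^ 2 ∂μ) ≤ b ^ 2 →
      - (∫ ω, ⟪g i ω, e i ω⟫ ∂μ) ≤ b * ε := by
    intro i b hi hb hA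
    have hV : ∫ ω, ‖e i ω‖ ^ 2 ∂μ ≤ ε ^ 2 := (hv i hi).trans
      (div_le_self (sq_nonneg _) (by exact_mod_cast hi))
    have := integral_mono ((ige i).const_mul (-(2 * b * ε)))
      (((ig2 i).const_mul (ε ^ 2)).add ((ie2 i).const_mul (b ^ 2)))
      (fun ω => by
        simp only [Pi.add_apply]
        have h1 := (abs_le.1 (abs_real_inner_le_norm (g i ω) (e i ω))).1
        have h2 : 0 < 2 * b * ε := by positivity
        have := mul_le_mul_of_nonneg_left h1 h2.le
        nlinarith [sq_nonneg (ε * ‖g i ω‖ - b * ‖e i ω‖)])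
    simp only [Pi.add_apply] at this
    rw [integral_add ((ig2 i).const_mul _) ((ie2 i).const_mul _), integral_const_mul,
      integral_const_mul, integral_const_mul] at this
    have h1 := mul_le_mul_of_nonneg_left hA (sq_nonneg ε)
    have h2 := mul_le_mul_of_nonneg_left hV (sq_nonneg b)
    have h3 : 0 < 2 * b * ε := by positivity
    refine le_of_mul_le_mul_left ?_ h3
    linarith
  have main : ∀ k : ℕ, 1 ≤ k → (∫ ω, ‖g k ω‖ ^ 2 ∂μ) ≤ (76 * D / k + 3 * ε) ^ 2 := by
    intro k
    induction k using Nat.strong_induction_on with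
    | _ k ih =>
    intro hk
    have sumb : ∀ n : ℕ, n + 1 ≤ k → ∑ i ∈ Finset.range (n + 1),
        (((i : ℝ) + 1) * (i + 2) / 2 * (∫ ω, ‖e i ω‖ ^ 2 ∂μ) - (i + 1) * ∫ ω, ⟪g i ω, e i ω⟫ ∂μ)
        ≤ ε ^ 2 / 8 + ε ^ 2 * (n * (n + 5) / 2) + 3 * ε ^ 2 * (n * (n + 3) / 2) + 152 * D * ε * n := by
      intro n
      induction n with
      | zero =>
        intro _
        simp [he0]
        linarith
      | succ n ihn =>
        intro hn
        rw [Finset.sum_range_succ]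
        have h0 := ihn (by omega)
        have h1 := hv (n+1) (by omega)
        have h2 := cross (n+1) _ (by omega) (by positivity) (ih (n+1) (by omega) (by omega))
        push_cast at h1 h2 ⊢
        have hn0 : (0:ℝ) ≤ n := Nat.cast_nonneg n
        have h1' : ((n : ℝ) + 1 + 1) * (n + 1 + 2) / 2 * (∫ ω, ‖e (n+1) ω‖ ^ 2 ∂μ) ≤ (n + 3) * ε ^ 2 := by
          refine (mul_le_mul_of_nonneg_left h1 (by positivity)).trans ?_
          rw [mul_div_assoc', div_le_iff₀ (by positivity)]
          nlinarith [mul_nonneg (mul_nonneg hn0 (by positivity : (0:ℝ) ≤ n + 3)) (sq_nonneg ε)]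
        have h2' : ((n : ℝ) + 1 + 1) * (-∫ ω, ⟪g (n+1) ω, e (n+1) ω⟫ ∂μ) ≤ 152 * D * ε + 3 * (n + 2) * ε ^ 2 := by
          refine (mul_le_mul_of_nonneg_left h2 (by positivity)).trans ?_
          have : ((n:ℝ) + 1 + 1) * (76 * D / (n + 1)) ≤ 152 * D := by
            rw [mul_div_assoc', div_le_iff₀ (by positivity)]
            nlinarith [mul_nonneg hn0 hD0]
          have := mul_le_mul_of_nonneg_right this hε.le
          linear_combination this
        linear_combination h0 + h1' + h2'
    obtain ⟨n, rfl⟩ : ∃ n, k = n + 1 := ⟨k - 1, by omega⟩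
    have h1 := sumb n le_rfl
    have h2 := avg (n + 1)
    push_cast at h2 ⊢
    have hn0 : (0:ℝ) ≤ n := Nat.cast_nonneg n
    set x := D / ((n:ℝ) + 1) with hx
    have hx0 : 0 ≤ x := by positivity
    have hDx : D = x * (n + 1) := by rw [hx]; field_simp
    set b := 76 * x + 3 * ε with hb
    have hbb : 76 * D / ((n:ℝ) + 1) + 3 * ε = b := by rw [hb, hx]; ring
    rw [hbb]
    have hb0 : 0 < b := by positivity
    have h3 := mean (n + 1) b hb0
    set A := ∫ ω, ‖g (n + 1) ω‖ ^ 2 ∂μ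
    set m := ∫ ω, ‖g (n + 1) ω‖ ∂μ
    have hm0 : 0 ≤ m := integral_nonneg fun ω => norm_nonneg _
    have h4 : A ≤ 2 * x * m + (4 * ε ^ 2 + 304 * x * ε) := by
      have hp : (0:ℝ) < (n + 2) * (n + 3) / 2 := by positivity
      refine le_of_mul_le_mul_left ?_ hp
      rw [hDx] at h1 h2
      have q1 : 0 ≤ x * m := by positivity
      have q2 : 0 ≤ x * ε := by positivity
      have q3 : 0 ≤ ε ^ 2 := by positivity
      have r1 := mul_nonneg hn0 q1
      have r2 := mul_nonneg hn0 q2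
      have r3 := mul_nonneg hn0 q3
      have s2 := mul_nonneg hn0 r2
      nlinarith
    have h5 : 4 * ε ^ 2 + 304 * x * ε ≤ b * (b - 2 * x) := by
      rw [hb]
      nlinarith [mul_nonneg hx0 hε.le, mul_nonneg hx0 hx0, sq_nonneg ε]
    have h6 : b * A ≤ x * (A + b ^ 2) + b * (b * (b - 2 * x)) := by
      have := mul_le_mul_of_nonneg_left h3 hx0
      have := mul_le_mul_of_nonneg_left (h4.trans (add_le_add_right h5 _)) hb0.le
      linarith
    have h7 : 0 < b - x := by rw [hb]; linarith
    refine le_of_mul_le_mul_left ?_ h7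
    linarith
  have hkp : (0:ℝ) < k := by exact_mod_cast hk
  have hb0 : 0 < 76 * D / k + 3 * ε := by positivity
  have h1 := mean k _ hb0
  have h2 := main k hk
  refine le_of_mul_le_mul_left ?_ (mul_pos two_pos hb0)
  linarith

/-- Convergence of the stochastic Halpern iteration
`u_k = (1/(k+1)) u_0 + (k/(k+1))(u_{k-1} − (1/L) F̃(u_{k-1}))` for a `(1/L)`-cocoercive operator
`F` with zero `u*`: if the estimates satisfy `E[F̃(u_0)] = F(u_0)`,
`E[‖F(u_0) − F̃(u_0)‖²] ≤ ε²/8` and `E[‖F(u_k) − F̃(u_k)‖²] ≤ ε²/k` for `k ≥ 1`, then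
`E[‖F(u_k)‖] ≤ Λ₀/k + Λ₁ ε` with `Λ₀ = 76 L ‖u_0 − u*‖`, `Λ₁ = 4√(2/3)`; in particular
`E[‖F(u_N)‖] ≤ 4ε` for `N = ⌈2Λ₀/ε⌉`. -/
theorem stochastic_halpern_cocoercive_convergence
    {d : ℕ} {Ω : Type*} [MeasureSpace Ω] [IsProbabilityMeasure (volume : Measure Ω)]
    (L ε : ℝ) (hL : 0 < L) (hε : 0 < ε)
    (F : EuclideanSpace ℝ (Fin d) → EuclideanSpace ℝ (Fin d))
    (hcoco : ∀ u v, (1 / L) * ‖F u - F v‖ ^ 2 ≤ ⟪F u - F v, u - v⟫)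
    (ustar : EuclideanSpace ℝ (Fin d)) (hstar : F ustar = 0)
    (u0 : EuclideanSpace ℝ (Fin d))
    (u Ft : ℕ → Ω → EuclideanSpace ℝ (Fin d))
    (hu0 : ∀ ω, u 0 ω = u0)
    (hrec : ∀ k : ℕ, 1 ≤ k → ∀ ω,
      u k ω = ((1 : ℝ) / ((k : ℝ) + 1)) • u0
        + (((k : ℝ)) / ((k : ℝ) + 1)) • (u (k - 1) ω - (1 / L) • Ft (k - 1) ω))
    (hintFt : ∀ k, Integrable (fun ω => Ft k ω))
    (hintVar : ∀ k, Integrable (fun ω => ‖F (u k ω) - Ft k ω‖ ^ 2))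
    (hintF : ∀ k, Integrable (fun ω => ‖F (u k ω)‖))
    (hunbiased0 : (∫ ω, Ft 0 ω) = F u0)
    (hvar0 : (∫ ω, ‖F (u 0 ω) - Ft 0 ω‖ ^ 2) ≤ ε ^ 2 / 8)
    (hvar : ∀ k : ℕ, 1 ≤ k → (∫ ω, ‖F (u k ω) - Ft k ω‖ ^ 2) ≤ ε ^ 2 / k) :
    (∀ k : ℕ, 1 ≤ k →
      (∫ ω, ‖F (u k ω)‖) ≤ 76 * L * ‖u0 - ustar‖ / k + (4 * Real.sqrt (2 / 3)) * ε)
    ∧ (∫ ω, ‖F (u (⌈2 * (76 * L * ‖u0 - ustar‖) / ε⌉₊) ω)‖) ≤ 4 * ε := by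
  have hL' : (1 / L) ≠ 0 := by positivity
  have hcG : ∀ x y, ‖(1 / L) • F x - (1 / L) • F y‖ ^ 2 ≤ ⟪(1 / L) • F x - (1 / L) • F y, x - y⟫ := by
    intro x y
    rw [← smul_sub, norm_smul, real_inner_smul_left, Real.norm_of_nonneg (by positivity)]
    have := mul_le_mul_of_nonneg_left (hcoco x y) (by positivity : (0:ℝ) ≤ 1 / L)
    linarith
  have hlip : ∀ x y, ‖(1 / L) • F x - (1 / L) • F y‖ ≤ ‖x - y‖ := by
    intro x y
    have h1 := hcG x y
    have h2 := real_inner_le_norm ((1 / L) • F x - (1 / L) • F y) (x - y)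
    by_contra! h
    nlinarith [norm_nonneg (x - y)]
  have hcont : Continuous (fun x => (1 / L) • F x) := by
    refine LipschitzWith.continuous (K := 1) (LipschitzWith.of_dist_le_mul fun x y => ?_)
    simpa [dist_eq_norm] using hlip x y
  have hG : ∀ k, MemLp (u k) 2 → MemLp (fun ω => (1 / L) • F (u k ω)) 2 := by
    intro k h
    have h1 : MemLp (fun ω => ‖u k ω‖ + ‖ustar‖) 2 := h.norm.add (memLp_const _)
    refine h1.mono (hcont.comp_aestronglyMeasurable h.1) (Filter.Eventually.of_forall fun ω => ?_)
    have h2 := hlip (u k ω) ustar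
    rw [hstar, smul_zero, sub_zero] at h2
    rw [Real.norm_of_nonneg (by positivity)]
    exact h2.trans (norm_sub_le _ _)
  have hFof : ∀ k, MemLp (u k) 2 → AEStronglyMeasurable (fun ω => F (u k ω)) := by
    intro k h
    have := (hG k h).1.const_smul L
    refine this.congr (Filter.Eventually.of_forall fun ω => ?_)
    simp [smul_smul, hL.ne']
  have hE : ∀ k, MemLp (u k) 2 → MemLp (fun ω => (1 / L) • (Ft k ω - F (u k ω))) 2 := by
    intro k h
    suffices h0 : MemLp (fun ω => Ft k ω - F (u k ω)) 2 from h0.const_smul (1 / L)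
    refine (memLp_two_iff_integrable_sq_norm ((hintFt k).1.sub (hFof k h))).2 ?_
    refine (hintVar k).congr (Filter.Eventually.of_forall fun ω => ?_)
    simp only [norm_sub_rev, Pi.sub_apply]
  have hrec' : ∀ (k : ℕ) ω, ((k : ℝ) + 2) • u (k+1) ω = u 0 ω + ((k : ℝ) + 1) •
      (u k ω - ((1 / L) • F (u k ω) + (1 / L) • (Ft k ω - F (u k ω)))) := by
    intro k ω
    rw [hrec (k+1) (by omega) ω, hu0, ← smul_add, add_sub_cancel, smul_add, smul_smul, smul_smul,
      Nat.add_sub_cancel]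
    push_cast
    have hk : (k:ℝ) + 1 + 1 ≠ 0 := by positivity
    have e1 : ((k:ℝ) + 2) * (1 / (k + 1 + 1)) = 1 := by field_simp; ring
    have e2 : ((k:ℝ) + 2) * ((k + 1) / (k + 1 + 1)) = k + 1 := by field_simp; ring
    rw [e1, e2, one_smul]
  have hU : ∀ k, MemLp (u k) 2 := by
    intro k
    induction k with
    | zero =>
      have : u 0 = fun _ => u0 := funext hu0
      rw [this]; exact memLp_const _
    | succ k ih =>
      have h0 : MemLp (u 0) 2 := by
        have : u 0 = fun _ => u0 := funext hu0
        rw [this]; exact memLp_const _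
      have h1 := (h0.add ((ih.sub ((hG k ih).add (hE k ih))).const_smul ((k:ℝ) + 1))).const_smul
        (((k:ℝ) + 2)⁻¹)
      refine (memLp_congr_ae (Filter.Eventually.of_forall fun ω => ?_)).1 h1
      simp only [Pi.smul_apply, Pi.add_apply, Pi.sub_apply]
      rw [← hrec' k ω, smul_smul, inv_mul_cancel₀ (by positivity), one_smul]
  have hvar' : ∀ k, (∫ ω, ‖(1 / L) • (Ft k ω - F (u k ω))‖ ^ 2)
      = (1 / L) ^ 2 * ∫ ω, ‖F (u k ω) - Ft k ω‖ ^ 2 := by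
    intro k
    rw [← integral_const_mul]
    congr 1
    ext ω
    rw [norm_smul, Real.norm_of_nonneg (by positivity), mul_pow, norm_sub_rev]
  have part1 : ∀ k : ℕ, 1 ≤ k → (∫ ω, ‖F (u k ω)‖) ≤ 76 * L * ‖u0 - ustar‖ / k + 3 * ε := by
    intro k hk
    have key := aux_core volume (ε / L) (by positivity) u (fun k ω => (1 / L) • F (u k ω))
      (fun k ω => (1 / L) • (Ft k ω - F (u k ω))) ustar u0 ((1 / L) • F u0) hu0
      (fun ω => by simp only [hu0]) hrec' (fun k ω => hcG _ _)
      (fun k ω => by simpa [hstar] using hcG (u k ω) ustar) (fun k => hG k (hU k))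
      (fun k => hE k (hU k)) ?_ ?_ ?_ k hk
    · simp only [norm_smul] at key
      rw [integral_const_mul, Real.norm_of_nonneg (by positivity)] at key
      have := mul_le_mul_of_nonneg_left key hL.le
      have e1 : L * (1 / L * ∫ ω, ‖F (u k ω)‖) = ∫ ω, ‖F (u k ω)‖ := by field_simp
      rw [e1] at this
      refine this.trans_eq ?_
      have : (k:ℝ) ≠ 0 := by positivity
      field_simp
    · simp only [hu0, real_inner_smul_left, real_inner_smul_right]
      rw [integral_const_mul, integral_const_mul, integral_inner (f := fun ω => Ft 0 ω - F u0)
          ((hintFt 0).sub (integrable_const _)),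
        integral_sub (hintFt 0) (integrable_const _), hunbiased0]
      simp
    · rw [hvar']
      have := mul_le_mul_of_nonneg_left hvar0 (sq_nonneg (1 / L))
      refine this.trans_eq ?_
      ring
    · intro k hk
      rw [hvar']
      have := mul_le_mul_of_nonneg_left (hvar k hk) (sq_nonneg (1 / L))
      refine this.trans_eq ?_
      ring
  refine ⟨fun k hk => (part1 k hk).trans ?_, ?_⟩
  · have : (3 / 4 : ℝ) ≤ Real.sqrt (2 / 3) := Real.le_sqrt_of_sq_le (by norm_num)
    have := mul_le_mul_of_nonneg_right this hε.le
    linarith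
  · set N := ⌈2 * (76 * L * ‖u0 - ustar‖) / ε⌉₊ with hN
    have hle := Nat.le_ceil (2 * (76 * L * ‖u0 - ustar‖) / ε)
    rw [← hN, div_le_iff₀ hε] at hle
    rcases Nat.eq_zero_or_pos N with h0 | hpos
    · rw [h0] at hle
      simp only [Nat.cast_zero, zero_mul] at hle
      have h1 : ‖u0 - ustar‖ = 0 := by
        by_contra hne
        have : 0 < ‖u0 - ustar‖ := lt_of_le_of_ne (norm_nonneg _) (Ne.symm hne)
        have : 0 < 2 * (76 * L * ‖u0 - ustar‖) := by positivity
        linarith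
      have h2 : u0 = ustar := sub_eq_zero.1 (norm_eq_zero.1 h1)
      rw [h0]
      simp only [hu0, h2, hstar, norm_zero, integral_zero]
      positivity
    · have hNp : (0:ℝ) < N := by exact_mod_cast hpos
      refine (part1 N hpos).trans ?_
      have : 76 * L * ‖u0 - ustar‖ / N ≤ ε := by
        rw [div_le_iff₀ hNp]
        have : 0 ≤ L * ‖u0 - ustar‖ := by positivity
        linarith
      linarith
end

section
/- Let F : ℝ^d → ℝ^d be monotone and L-Lipschitz with a zero u* (F(u*) = 0). Let M = 9L², 0 < η₀ ≤ 1/(3√3 L), λ_k = 1/(k+2), and define η_{k+1} = ((1 − λ_k² − M η_k²) λ_{k+1} η_k) / ((1 − M η_k²)(1 − λ_k) λ_k), and set η̲ = η₀(1 − 2Mη₀²)/(1 − Mη₀²). On a probability space, starting from the deterministic points v_{-1} = u_0 ∈ ℝ^d, let random vectors evolve for k ≥ 1 by the extrapolated stochastic Halpern iteration: v_{k-1} = (1/(k+1)) u_0 + (k/(k+1)) u_{k-1} − η_{k-1} F̃(v_{k-2}) and u_k = (1/(k+1)) u_0 + (k/(k+1)) u_{k-1} − η_{k-1} F̃(v_{k-1}),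 where the F̃(v_i) are random vectors. Assume, for a given ε > 0, that E[‖F(v_i) − F̃(v_i)‖²] ≤ ε²/8 for i ∈ {−1, 0} and E[‖F(v_i) − F̃(v_i)‖²] ≤ ε²/i for all i ≥ 1. Then for all k ≥ 2, E[‖F(u_k)‖² + 2L²‖u_k − v_{k-1}‖²] ≤ Λ₀/((k+1)(k+2)) + Λ₁ ε², where Λ₀ = 4(L²η₀η̲ + 1)‖u_0 − u*‖²/η̲² and Λ₁ = 5(1 + Mη̲η₀)/(Mη̲²). In particular, E[‖F(u_N)‖² + 2L²‖u_N − v_{N-1}‖²] ≤ 2Λ₁ε² for N = ⌈√Λ₀/(√Λ₁ ε)⌉. -/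
open MeasureTheory
open scoped RealInnerProductSpace

lemma esh_eta (M : ℝ) (hM : 0 < M) (η : ℕ → ℝ) (h0 : 0 < η 0) (hx : M * η 0 ^ 2 ≤ 1 / 3)
    (hηrec : ∀ k : ℕ,
      η (k + 1) =
        ((1 - (1 / ((k : ℝ) + 2)) ^ 2 - M * η k ^ 2) * (1 / ((k : ℝ) + 3)) * η k) /
          ((1 - M * η k ^ 2) * (1 - 1 / ((k : ℝ) + 2)) * (1 / ((k : ℝ) + 2))))
    (ηlow : ℝ) (hηlow : ηlow = η 0 * (1 - 2 * M * η 0 ^ 2) / (1 - M * η 0 ^ 2)) :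
    0 < ηlow ∧ ∀ k, ηlow ≤ η k ∧ η k ≤ η 0 := by
  have hx0 : 0 < M * η 0 ^ 2 := by positivity
  set x := M * η 0 ^ 2 with hxdef
  have h1x : 0 < 1 - x := by linarith
  set z := x / (1 - x) with hz
  have hz0 : 0 < z := by positivity
  have hz1 : z ≤ 1 / 2 := by rw [hz, div_le_iff₀ h1x]; linarith
  have hlow : ηlow = η 0 * (1 - z) := by
    rw [hηlow, hz]; field_simp; rw [hxdef]; ring
  have hlowpos : 0 < ηlow := by rw [hlow]; apply mul_pos h0; linarith
  refine ⟨hlowpos, ?_⟩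
  have key : ∀ k : ℕ, η 0 * (1 - z * (1 - 1 / ((k : ℝ) + 1))) ≤ η k ∧ η k ≤ η 0 := by
    intro k
    induction k with
    | zero => simp
    | succ k ih =>
      obtain ⟨ih1, ih2⟩ := ih
      have hk : (0 : ℝ) ≤ k := Nat.cast_nonneg k
      have hfrac : 0 < 1 / ((k : ℝ) + 1) := by positivity
      have hpos : 0 < η k := by
        have : z * (1 - 1 / ((k : ℝ) + 1)) ≤ z := by nlinarith
        have : 0 < η 0 * (1 - z * (1 - 1 / ((k : ℝ) + 1))) := by
          apply mul_pos h0; linarith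
        linarith
      have hxk0 : 0 < M * η k ^ 2 := by positivity
      have hxk : M * η k ^ 2 ≤ x := by
        rw [hxdef]; gcongr
      have h1xk : 0 < 1 - M * η k ^ 2 := by linarith
      have hrec : η (k + 1) = η k - η k * (M * η k ^ 2 / (1 - M * η k ^ 2)) *
          (1 / (((k : ℝ) + 1) * ((k : ℝ) + 3))) := by
        rw [hηrec k]
        have e1 : (1 : ℝ) - 1 / ((k : ℝ) + 2) = (k + 1) / (k + 2) := by field_simp; ring
        rw [e1]
        generalize M * η k ^ 2 = y at *
        field_simp
        ring
      have hy : M * η k ^ 2 / (1 - M * η k ^ 2) ≤ z := by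
        rw [hz]; gcongr
      have hy0 : 0 < M * η k ^ 2 / (1 - M * η k ^ 2) := by positivity
      generalize M * η k ^ 2 / (1 - M * η k ^ 2) = y at *
      have hfr : 1 / (((k : ℝ) + 1) * ((k : ℝ) + 3)) ≤ 1 / ((k : ℝ) + 1) - 1 / ((k : ℝ) + 1 + 1) := by
        rw [div_sub_div _ _ (by positivity) (by positivity), div_le_div_iff₀ (by positivity) (by positivity)]
        nlinarith
      have hprod : η k * y * (1 / (((k : ℝ) + 1) * ((k : ℝ) + 3))) ≤
          η 0 * z * (1 / ((k : ℝ) + 1) - 1 / ((k : ℝ) + 1 + 1)) := by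
        gcongr
      constructor
      · push_cast
        rw [hrec]; linarith
      · rw [hrec]
        have : 0 ≤ η k * y * (1 / (((k : ℝ) + 1) * ((k : ℝ) + 3))) := by positivity
        linarith
  intro k
  refine ⟨?_, (key k).2⟩
  refine le_trans ?_ (key k).1
  rw [hlow]
  have : 0 < 1 / ((k : ℝ) + 1) := by positivity
  apply mul_le_mul_of_nonneg_left _ h0.le
  nlinarith

lemma esh_young {E : Type*} [NormedAddCommGroup E] [InnerProductSpace ℝ E]
    (L η : ℝ) (hL : 0 < L) (hη : 0 < η) (F1 Fv1 G1 F0 Fv0 G0 : E) (w1 w0 : ℝ) (hw0 : 0 ≤ w0)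
    (h1 : ‖F1 - Fv1‖ ≤ L * w1) (h0 : ‖F0 - Fv0‖ ≤ L * w0) (hw : w1 = η * ‖G0 - G1‖) :
    ‖F1 - G1‖ ^ 2 + 2 * L ^ 2 * w1 ^ 2 ≤ 9 * L ^ 2 * η ^ 2 * (‖G1 - F0‖ ^ 2 + 2 * L ^ 2 * w0 ^ 2
      + 4 / 3 * ‖Fv0 - G0‖ ^ 2) + 2 * ‖Fv1 - G1‖ ^ 2 := by
  have t1 : ‖F1 - G1‖ ≤ L * w1 + ‖Fv1 - G1‖ := by
    have := norm_add_le (F1 - Fv1) (Fv1 - G1)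
    rw [sub_add_sub_cancel] at this; linarith
  have t2 : ‖G0 - G1‖ ≤ ‖G1 - F0‖ + L * w0 + ‖Fv0 - G0‖ := by
    have e : G0 - G1 = -((G1 - F0) + (F0 - Fv0) + (Fv0 - G0)) := by abel
    rw [e, norm_neg]
    have := norm_add₃_le (a := G1 - F0) (b := F0 - Fv0) (c := Fv0 - G0)
    linarith
  have q1 : ‖F1 - G1‖ ^ 2 ≤ (L * w1 + ‖Fv1 - G1‖) ^ 2 := by gcongr
  have q2 : ‖G0 - G1‖ ^ 2 ≤ (‖G1 - F0‖ + L * w0 + ‖Fv0 - G0‖) ^ 2 := by gcongr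
  have q3 : (‖G1 - F0‖ + L * w0 + ‖Fv0 - G0‖) ^ 2 ≤
      9 / 4 * (‖G1 - F0‖ ^ 2 + 2 * L ^ 2 * w0 ^ 2 + 4 / 3 * ‖Fv0 - G0‖ ^ 2) := by
    generalize ‖G1 - F0‖ = a
    generalize ‖Fv0 - G0‖ = c
    have : 2 * L ^ 2 * w0 ^ 2 = 2 * (L * w0) ^ 2 := by ring
    rw [this]
    generalize L * w0 = b
    nlinarith [sq_nonneg (a - 2 * b), sq_nonneg (3 * a - 4 * c), sq_nonneg (3 * b - 2 * c)]
  have q4 : 4 * L ^ 2 * w1 ^ 2 ≤ 9 * L ^ 2 * η ^ 2 * (‖G1 - F0‖ ^ 2 + 2 * L ^ 2 * w0 ^ 2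
      + 4 / 3 * ‖Fv0 - G0‖ ^ 2) := by
    rw [hw]
    calc 4 * L ^ 2 * (η * ‖G0 - G1‖) ^ 2 = 4 * L ^ 2 * η ^ 2 * ‖G0 - G1‖ ^ 2 := by ring
      _ ≤ 4 * L ^ 2 * η ^ 2 * (9 / 4 * (‖G1 - F0‖ ^ 2 + 2 * L ^ 2 * w0 ^ 2 + 4 / 3 * ‖Fv0 - G0‖ ^ 2)) := by
        apply mul_le_mul_of_nonneg_left (q2.trans q3) (by positivity)
      _ = _ := by ring
  nlinarith [sq_nonneg (L * w1 - ‖Fv1 - G1‖)]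

lemma esh_quad {E : Type*} [NormedAddCommGroup E] [InnerProductSpace ℝ E]
    (F G : E) (A q m : ℝ) (hq : 0 < q) (h : A * q = m ^ 2) :
    0 ≤ A * ‖F‖ ^ 2 + q * ‖G‖ ^ 2 - 2 * m * ⟪F, G⟫ := by
  have h1 : 0 ≤ ‖q • G - m • F‖ ^ 2 := by positivity
  rw [norm_sub_sq_real, norm_smul, norm_smul, real_inner_smul_left, real_inner_smul_right,
    mul_pow, mul_pow, Real.norm_eq_abs, Real.norm_eq_abs, sq_abs, sq_abs, ← h,
    real_inner_comm] at h1
  have : 0 ≤ q * (A * ‖F‖ ^ 2 + q * ‖G‖ ^ 2 - 2 * m * ⟪F, G⟫) := by nlinarith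
  exact nonneg_of_mul_nonneg_right this hq

lemma esh_step {E : Type*} [NormedAddCommGroup E] [InnerProductSpace ℝ E]
    (L M : ℝ) (hL : 0 < L) (hM : M = 9 * L ^ 2) (k : ℝ) (hk : 0 ≤ k) (η η' : ℝ) (hη : 0 < η)
    (hx : M * η ^ 2 ≤ 1 / 3)
    (hrec : η' = ((1 - (1 / (k + 2)) ^ 2 - M * η ^ 2) * (1 / (k + 3)) * η) /
          ((1 - M * η ^ 2) * (1 - 1 / (k + 2)) * (1 / (k + 2))))
    (F : E → E) (hmono : ∀ x y, 0 ≤ ⟪F x - F y, x - y⟫)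
    (hlip : ∀ x y, ‖F x - F y‖ ≤ L * ‖x - y‖)
    (c u v G u' v' G' : E)
    (hv' : v' = ((1 : ℝ) / (k + 2)) • c + ((k + 1) / (k + 2)) • u - η • G)
    (hu' : u' = ((1 : ℝ) / (k + 2)) • c + ((k + 1) / (k + 2)) • u - η • G') :
    (k + 2) * (k + 3) * η' / 2 * (‖F u'‖ ^ 2 + 2 * L ^ 2 * ‖u' - v'‖ ^ 2)
      + (k + 2) * ⟪F u', u' - c⟫ ≤
    (k + 1) * (k + 2) * η / 2 * (‖F u‖ ^ 2 + 2 * L ^ 2 * ‖u - v‖ ^ 2)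
      + (k + 1) * ⟪F u, u - c⟫
      + (k + 1) * (k + 2) * (2 / 3 * η * ‖F v - G‖ ^ 2 + 1 / (M * η) * ‖F v' - G'‖ ^ 2) := by
  have hMpos : 0 < M := by rw [hM]; positivity
  have hw : ‖u' - v'‖ = η * ‖G - G'‖ := by
    have : u' - v' = η • (G - G') := by rw [hu', hv', smul_sub]; abel
    rw [this, norm_smul, Real.norm_eq_abs, abs_of_pos hη]
  have hY := esh_young L η hL hη (F u') (F v') G' (F u) (F v) G ‖u' - v'‖ ‖u - v‖
    (norm_nonneg _) (hlip _ _) (hlip _ _) hw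
  rw [← hM] at hY
  have h1x : 0 < 1 - M * η ^ 2 := by linarith
  set p := (k + 1) * (k + 2) / (2 * M * η) with hp
  have hppos : 0 < p := by positivity
  set a := (k + 1) * (k + 2) * η / 2 with ha
  set a' := (k + 2) * (k + 3) * η' / 2 with ha'
  have hpa : p * (M * η ^ 2) = a := by rw [hp, ha]; field_simp
  have hqpos : 0 < p - a := by
    rw [← hpa]; nlinarith
  have hAq : (p - a') * (p - a) = (p - (k + 2) ^ 2 * η / 2) ^ 2 := by
    have e1 : (1 : ℝ) - 1 / (k + 2) = (k + 1) / (k + 2) := by field_simp; ring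
    rw [ha', ha, hp, hrec, e1]
    have := h1x.ne'
    field_simp
    ring
  have hQ := esh_quad (F u') G' (p - a') (p - a) (p - (k + 2) ^ 2 * η / 2) hqpos hAq
  have hpa' : 0 ≤ p - a' := by
    have : 0 ≤ (p - a') * (p - a) := by rw [hAq]; positivity
    exact nonneg_of_mul_nonneg_left this hqpos
  have hmon := hmono u' u
  have d1 : (k + 1) • (u' - u) = (c - u') - ((k + 2) * η) • G' := by
    rw [hu']
    match_scalars <;> field_simp <;> ring
  have d2 : (k + 2) • (u' - u) = (c - u) - ((k + 2) * η) • G' := by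
    rw [hu']
    match_scalars <;> field_simp <;> ring
  have i1 : (k + 1) * ⟪F u', u' - u⟫ = - ⟪F u', u' - c⟫ - (k + 2) * η * ⟪F u', G'⟫ := by
    rw [← real_inner_smul_right, d1, inner_sub_right, real_inner_smul_right, ← neg_sub u' c,
      inner_neg_right]
  have i2 : (k + 2) * ⟪F u, u' - u⟫ = - ⟪F u, u - c⟫ - (k + 2) * η * ⟪F u, G'⟫ := by
    rw [← real_inner_smul_right, d2, inner_sub_right, real_inner_smul_right, ← neg_sub u c,
      inner_neg_right]
  rw [inner_sub_left] at hmon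
  have hmon2 : 0 ≤ (k + 2) * ((k + 1) * ⟪F u', u' - u⟫) - (k + 1) * ((k + 2) * ⟪F u, u' - u⟫) := by
    have : 0 ≤ (k + 1) * (k + 2) * (⟪F u', u' - u⟫ - ⟪F u, u' - u⟫) := by positivity
    linarith
  rw [i1, i2] at hmon2
  have hY2 := mul_le_mul_of_nonneg_left hY hppos.le
  have e3 : p * (M * η ^ 2 * (‖G' - F u‖ ^ 2 + 2 * L ^ 2 * ‖u - v‖ ^ 2 + 4 / 3 * ‖F v - G‖ ^ 2)
      + 2 * ‖F v' - G'‖ ^ 2) = a * (‖G' - F u‖ ^ 2 + 2 * L ^ 2 * ‖u - v‖ ^ 2 + 4 / 3 * ‖F v - G‖ ^ 2)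
      + 2 * p * ‖F v' - G'‖ ^ 2 := by rw [← hpa]; ring
  rw [e3, norm_sub_sq_real (F u') G', norm_sub_sq_real G' (F u), real_inner_comm (F u) G'] at hY2
  have e4 : (k + 1) * (k + 2) * (2 / 3 * η * ‖F v - G‖ ^ 2 + 1 / (M * η) * ‖F v' - G'‖ ^ 2)
      = 4 / 3 * a * ‖F v - G‖ ^ 2 + 2 * p * ‖F v' - G'‖ ^ 2 := by
    rw [ha, hp]; field_simp; ring
  rw [e4]
  have hw2 : 0 ≤ (p - a') * (2 * L ^ 2 * ‖u' - v'‖ ^ 2) := by positivity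
  have e5 : (k + 1) * ((k + 2) * η * ⟪F u, G'⟫) = 2 * a * ⟪F u, G'⟫ := by rw [ha]; ring
  linarith

lemma esh_path {E : Type*} [NormedAddCommGroup E] [InnerProductSpace ℝ E]
    (L M : ℝ) (hL : 0 < L) (hM : M = 9 * L ^ 2) (η : ℕ → ℝ) (ηlow : ℝ) (hlow : 0 < ηlow)
    (hη : ∀ k, ηlow ≤ η k ∧ η k ≤ η 0)
    (hx : M * η 0 ^ 2 ≤ 1 / 3)
    (hrec : ∀ k : ℕ,
      η (k + 1) =
        ((1 - (1 / ((k : ℝ) + 2)) ^ 2 - M * η k ^ 2) * (1 / ((k : ℝ) + 3)) * η k) /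
          ((1 - M * η k ^ 2) * (1 - 1 / ((k : ℝ) + 2)) * (1 / ((k : ℝ) + 2))))
    (F : E → E) (hmono : ∀ x y, 0 ≤ ⟪F x - F y, x - y⟫)
    (hlip : ∀ x y, ‖F x - F y‖ ≤ L * ‖x - y‖) (us : E) (hus : F us = 0)
    (c : E) (u v G : ℕ → E) (hu0 : u 0 = c) (hv0 : v 0 = c)
    (hv : ∀ k : ℕ, v (k + 1) = ((1 : ℝ) / ((k : ℝ) + 2)) • c
      + (((k : ℝ) + 1) / ((k : ℝ) + 2)) • u k - η k • G k)
    (hu : ∀ k : ℕ, u (k + 1) = ((1 : ℝ) / ((k : ℝ) + 2)) • c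
      + (((k : ℝ) + 1) / ((k : ℝ) + 2)) • u k - η k • G (k + 1)) (k : ℕ) :
    ‖F (u k)‖ ^ 2 + 2 * L ^ 2 * ‖u k - v k‖ ^ 2 ≤
      4 * (L ^ 2 * η 0 * ηlow + 1) * ‖c - us‖ ^ 2 / ηlow ^ 2 / (((k : ℝ) + 1) * ((k : ℝ) + 2))
      + 4 / (((k : ℝ) + 1) * ((k : ℝ) + 2) * ηlow) * ∑ i ∈ Finset.range k,
        (((i : ℝ) + 1) * ((i : ℝ) + 2) * (2 / 3 * η 0) * ‖F (v i) - G i‖ ^ 2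
        + ((i : ℝ) + 1) * ((i : ℝ) + 2) * (1 / (M * ηlow)) * ‖F (v (i + 1)) - G (i + 1)‖ ^ 2) := by
  have hMpos : 0 < M := by rw [hM]; positivity
  have hηp : ∀ k, 0 < η k := fun k => hlow.trans_le (hη k).1
  set T : ℕ → ℝ := fun k => ∑ i ∈ Finset.range k,
        (((i : ℝ) + 1) * ((i : ℝ) + 2) * (2 / 3 * η 0) * ‖F (v i) - G i‖ ^ 2
        + ((i : ℝ) + 1) * ((i : ℝ) + 2) * (1 / (M * ηlow)) * ‖F (v (i + 1)) - G (i + 1)‖ ^ 2) with hT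
  have hTk : 0 ≤ T k := by
    have := (hηp 0).le
    apply Finset.sum_nonneg; intro i _; positivity
  have hV : ((k : ℝ) + 1) * ((k : ℝ) + 2) * η k / 2 * (‖F (u k)‖ ^ 2 + 2 * L ^ 2 * ‖u k - v k‖ ^ 2)
      + ((k : ℝ) + 1) * ⟪F (u k), u k - c⟫ ≤ η 0 * ‖F c‖ ^ 2 + T k := by
    clear hTk
    induction k with
    | zero => simp [hT, hu0, hv0]
    | succ k ih =>
      have hs := esh_step L M hL hM (k : ℝ) (Nat.cast_nonneg k) (η k) (η (k + 1)) (hηp k)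
        (le_trans (by have := (hη k).2; have := (hηp k).le; gcongr) hx) (hrec k) F hmono hlip c
        (u k) (v k) (G k) (u (k + 1)) (v (k + 1)) (G (k + 1)) (hv k) (hu k)
      have hTs : T (k + 1) = T k + (((k : ℝ) + 1) * ((k : ℝ) + 2) * (2 / 3 * η 0) * ‖F (v k) - G k‖ ^ 2
        + ((k : ℝ) + 1) * ((k : ℝ) + 2) * (1 / (M * ηlow)) * ‖F (v (k + 1)) - G (k + 1)‖ ^ 2) := by
        rw [hT]; exact Finset.sum_range_succ _ _
      have hle : ((k : ℝ) + 1) * ((k : ℝ) + 2) * (2 / 3 * η k * ‖F (v k) - G k‖ ^ 2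
          + 1 / (M * η k) * ‖F (v (k + 1)) - G (k + 1)‖ ^ 2) ≤
          ((k : ℝ) + 1) * ((k : ℝ) + 2) * (2 / 3 * η 0 * ‖F (v k) - G k‖ ^ 2
          + 1 / (M * ηlow) * ‖F (v (k + 1)) - G (k + 1)‖ ^ 2) := by
        have h1 := (hη k).1
        have h2 := (hη k).2
        gcongr
      rw [hTs]
      push_cast
      have e1 : (k : ℝ) + 1 + 1 = k + 2 := by ring
      have e2 : (k : ℝ) + 1 + 2 = k + 3 := by ring
      rw [e1, e2]
      linarith
  set D := ‖c - us‖ with hD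
  have hFc : ‖F c‖ ^ 2 ≤ L ^ 2 * D ^ 2 := by
    have := hlip c us
    rw [hus, sub_zero] at this
    calc ‖F c‖ ^ 2 ≤ (L * D) ^ 2 := by gcongr
      _ = _ := by ring
  have hin : - (‖F (u k)‖ * D) ≤ ⟪F (u k), u k - c⟫ := by
    have h1 := hmono (u k) us
    rw [hus, sub_zero] at h1
    have h2 := real_inner_le_norm (F (u k)) (c - us)
    have h3 : u k - c = (u k - us) - (c - us) := by abel
    rw [h3, inner_sub_right]
    linarith
  have hk : (0 : ℝ) ≤ k := Nat.cast_nonneg k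
  set Φ := ‖F (u k)‖ ^ 2 + 2 * L ^ 2 * ‖u k - v k‖ ^ 2 with hΦ
  have hΦF : ‖F (u k)‖ ^ 2 ≤ Φ := by rw [hΦ]; have : 0 ≤ 2 * L ^ 2 * ‖u k - v k‖ ^ 2 := by positivity
                                     linarith
  -- lower the step size
  have hV2 : ((k : ℝ) + 1) * ((k : ℝ) + 2) * ηlow / 2 * Φ - ((k : ℝ) + 1) * (‖F (u k)‖ * D)
      ≤ η 0 * (L ^ 2 * D ^ 2) + T k := by
    have h1 : ((k : ℝ) + 1) * ((k : ℝ) + 2) * ηlow / 2 * Φ ≤ ((k : ℝ) + 1) * ((k : ℝ) + 2) * η k / 2 * Φ := by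
      have := (hη k).1
      gcongr
    have h2 : ((k : ℝ) + 1) * (-(‖F (u k)‖ * D)) ≤ ((k : ℝ) + 1) * ⟪F (u k), u k - c⟫ := by gcongr
    have h3 : η 0 * ‖F c‖ ^ 2 ≤ η 0 * (L ^ 2 * D ^ 2) := mul_le_mul_of_nonneg_left hFc (hηp 0).le
    linarith
  have hyoung : ((k : ℝ) + 1) * (‖F (u k)‖ * D) ≤ ((k : ℝ) + 1) * ((k : ℝ) + 2) * ηlow / 4 * Φ
      + D ^ 2 / ηlow := by
    have h1 : ((k : ℝ) + 1) * (‖F (u k)‖ * D) ≤ (((k : ℝ) + 1) * ‖F (u k)‖) ^ 2 * ηlow / 4 + D ^ 2 / ηlow := by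
      have h5 : (((k : ℝ) + 1) * ‖F (u k)‖) ^ 2 * ηlow / 4 + D ^ 2 / ηlow - ((k : ℝ) + 1) * (‖F (u k)‖ * D)
        = (((k : ℝ) + 1) * ‖F (u k)‖ * ηlow / 2 - D) ^ 2 / ηlow := by field_simp; ring
      have h6 : 0 ≤ (((k : ℝ) + 1) * ‖F (u k)‖ * ηlow / 2 - D) ^ 2 / ηlow := by positivity
      linarith
    have h2 : (((k : ℝ) + 1) * ‖F (u k)‖) ^ 2 * ηlow / 4 ≤ ((k : ℝ) + 1) * ((k : ℝ) + 2) * ηlow / 4 * Φ := by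
      calc (((k : ℝ) + 1) * ‖F (u k)‖) ^ 2 * ηlow / 4
          = ((k : ℝ) + 1) * ((k : ℝ) + 1) * ηlow / 4 * ‖F (u k)‖ ^ 2 := by ring
        _ ≤ _ := by gcongr; norm_num
    linarith
  have hfin : ((k : ℝ) + 1) * ((k : ℝ) + 2) * ηlow / 4 * Φ ≤ η 0 * (L ^ 2 * D ^ 2) + D ^ 2 / ηlow + T k := by
    linarith
  have hc : 0 < ((k : ℝ) + 1) * ((k : ℝ) + 2) * ηlow / 4 := by positivity
  calc Φ ≤ (η 0 * (L ^ 2 * D ^ 2) + D ^ 2 / ηlow + T k) / (((k : ℝ) + 1) * ((k : ℝ) + 2) * ηlow / 4) := by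
        rw [le_div_iff₀ hc]; linarith
    _ = 4 * (L ^ 2 * η 0 * ηlow + 1) * D ^ 2 / ηlow ^ 2 / (((k : ℝ) + 1) * ((k : ℝ) + 2))
      + 4 / (((k : ℝ) + 1) * ((k : ℝ) + 2) * ηlow) * T k := by
        generalize T k = t
        field_simp

lemma esh_sum1 (e : ℝ) (he : 0 ≤ e) (E : ℕ → ℝ) (h01 : ∀ j, j ≤ 1 → E j ≤ e / 8)
    (h2 : ∀ j : ℕ, 2 ≤ j → E j ≤ e / ((j : ℝ) - 1)) (k : ℕ) :
    ∑ i ∈ Finset.range k, ((i : ℝ) + 1) * ((i : ℝ) + 2) * E i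
      ≤ 15 / 8 * (((k : ℝ) + 1) * ((k : ℝ) + 2)) * e := by
  induction k with
  | zero => simp; linarith
  | succ k ih =>
    rw [Finset.sum_range_succ]
    have hk : (0 : ℝ) ≤ k := Nat.cast_nonneg k
    have : ((k : ℝ) + 1) * E k ≤ 15 / 4 * e := by
      rcases Nat.lt_or_ge k 2 with h | h
      · have h1 := h01 k (by omega)
        have h3 : (k : ℝ) ≤ 1 := by exact_mod_cast (by omega : k ≤ 1)
        nlinarith
      · have h1 := h2 k h
        have h3 : (2 : ℝ) ≤ k := by exact_mod_cast h
        calc ((k : ℝ) + 1) * E k ≤ ((k : ℝ) + 1) * (e / ((k : ℝ) - 1)) := by gcongr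
          _ ≤ 15 / 4 * e := by
            rw [← mul_div_assoc, div_le_iff₀ (by linarith)]; nlinarith
    push_cast
    nlinarith

lemma esh_sum2 (e : ℝ) (he : 0 ≤ e) (E : ℕ → ℝ) (h01 : ∀ j, j ≤ 1 → E j ≤ e / 8)
    (h2 : ∀ j : ℕ, 2 ≤ j → E j ≤ e / ((j : ℝ) - 1)) (k : ℕ) :
    ∑ i ∈ Finset.range k, ((i : ℝ) + 1) * ((i : ℝ) + 2) * E (i + 1)
      ≤ 5 / 4 * (((k : ℝ) + 1) * ((k : ℝ) + 2)) * e := by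
  induction k with
  | zero => simp; linarith
  | succ k ih =>
    rw [Finset.sum_range_succ]
    have hk : (0 : ℝ) ≤ k := Nat.cast_nonneg k
    have : ((k : ℝ) + 1) * E (k + 1) ≤ 5 / 2 * e := by
      rcases Nat.lt_or_ge k 1 with h | h
      · have h1 := h01 (k + 1) (by omega)
        have h3 : k = 0 := by omega
        subst h3
        norm_num at h1 ⊢
        linarith
      · have h1 := h2 (k + 1) (by omega)
        have h3 : (1 : ℝ) ≤ k := by exact_mod_cast h
        push_cast at h1
        rw [add_sub_cancel_right] at h1
        calc ((k : ℝ) + 1) * E (k + 1) ≤ ((k : ℝ) + 1) * (e / (k : ℝ)) := by gcongr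
          _ ≤ 5 / 2 * e := by
            rw [← mul_div_assoc, div_le_iff₀ (by linarith)]; nlinarith
    push_cast
    nlinarith

/-- Convergence of the extrapolated stochastic Halpern iteration for a monotone
`L`-Lipschitz operator `F` with zero `u*`. Here `v j` denotes the extrapolation point `v_{j-1}`
(shifted index, so `v 0 = v_{-1} = u_0`) and `Ftv j` the stochastic estimate `F̃(v_{j-1})`.
With `M = 9L²`, the step sizes `η_k` given by the recursion with `λ_k = 1/(k+2)`,
`η̲ = η₀(1−2Mη₀²)/(1−Mη₀²)`, `Λ₀ = 4(L²η₀η̲+1)‖u_0−u*‖²/η̲²` and `Λ₁ = 5(1+Mη̲η₀)/(Mη̲²)`,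
if the estimator errors satisfy `E‖F(v_i) − F̃(v_i)‖² ≤ ε²/8` for `i ∈ {−1,0}` and `≤ ε²/i`
for `i ≥ 1`, then for every `k ≥ 2`,
`E[‖F(u_k)‖² + 2L²‖u_k − v_{k-1}‖²] ≤ Λ₀/((k+1)(k+2)) + Λ₁ε²`, and in particular the bound
`2Λ₁ε²` holds at `N = ⌈√Λ₀/(√Λ₁ ε)⌉`. -/
theorem extrapolated_stochastic_halpern_convergence
    {d : ℕ} {Ω : Type*} [MeasureSpace Ω] [IsProbabilityMeasure (volume : Measure Ω)]
    (L ε : ℝ) (hL : 0 < L) (hε : 0 < ε)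
    (F : EuclideanSpace ℝ (Fin d) → EuclideanSpace ℝ (Fin d))
    (hmono : ∀ x y, 0 ≤ ⟪F x - F y, x - y⟫)
    (hlip : ∀ x y, ‖F x - F y‖ ≤ L * ‖x - y‖)
    (ustar : EuclideanSpace ℝ (Fin d)) (hstar : F ustar = 0)
    (M : ℝ) (hM : M = 9 * L ^ 2)
    (η : ℕ → ℝ) (hη0pos : 0 < η 0) (hη0le : η 0 ≤ 1 / (3 * Real.sqrt 3 * L))
    (hηrec : ∀ k : ℕ,
      η (k + 1) =
        ((1 - (1 / ((k : ℝ) + 2)) ^ 2 - M * η k ^ 2) * (1 / ((k : ℝ) + 3)) * η k) /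
          ((1 - M * η k ^ 2) * (1 - 1 / ((k : ℝ) + 2)) * (1 / ((k : ℝ) + 2))))
    (u0 : EuclideanSpace ℝ (Fin d))
    (ηlow Λ0 Λ1 : ℝ)
    (hηlow : ηlow = η 0 * (1 - 2 * M * η 0 ^ 2) / (1 - M * η 0 ^ 2))
    (hΛ0 : Λ0 = 4 * (L ^ 2 * η 0 * ηlow + 1) * ‖u0 - ustar‖ ^ 2 / ηlow ^ 2)
    (hΛ1 : Λ1 = 5 * (1 + M * ηlow * η 0) / (M * ηlow ^ 2))
    (u v Ftv : ℕ → Ω → EuclideanSpace ℝ (Fin d))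
    (hu0 : ∀ ω, u 0 ω = u0) (hv0 : ∀ ω, v 0 ω = u0)
    (hvrec : ∀ k : ℕ, 1 ≤ k → ∀ ω,
      v k ω = ((1 : ℝ) / ((k : ℝ) + 1)) • u0
        + (((k : ℝ)) / ((k : ℝ) + 1)) • u (k - 1) ω - η (k - 1) • Ftv (k - 1) ω)
    (hurec : ∀ k : ℕ, 1 ≤ k → ∀ ω,
      u k ω = ((1 : ℝ) / ((k : ℝ) + 1)) • u0
        + (((k : ℝ)) / ((k : ℝ) + 1)) • u (k - 1) ω - η (k - 1) • Ftv k ω)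
    (hintErr : ∀ j, Integrable (fun ω => ‖F (v j ω) - Ftv j ω‖ ^ 2))
    (hintF : ∀ k, Integrable
      (fun ω => ‖F (u k ω)‖ ^ 2 + 2 * L ^ 2 * ‖u k ω - v k ω‖ ^ 2))
    (herr01 : ∀ j : ℕ, j ≤ 1 → (∫ ω, ‖F (v j ω) - Ftv j ω‖ ^ 2) ≤ ε ^ 2 / 8)
    (herr : ∀ j : ℕ, 2 ≤ j →
      (∫ ω, ‖F (v j ω) - Ftv j ω‖ ^ 2) ≤ ε ^ 2 / ((j : ℝ) - 1)) :
    (∀ k : ℕ, 2 ≤ k →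
      (∫ ω, (‖F (u k ω)‖ ^ 2 + 2 * L ^ 2 * ‖u k ω - v k ω‖ ^ 2))
        ≤ Λ0 / (((k : ℝ) + 1) * ((k : ℝ) + 2)) + Λ1 * ε ^ 2)
    ∧ ((∫ ω, (‖F (u (⌈Real.sqrt Λ0 / (Real.sqrt Λ1 * ε)⌉₊) ω)‖ ^ 2
          + 2 * L ^ 2 * ‖u (⌈Real.sqrt Λ0 / (Real.sqrt Λ1 * ε)⌉₊) ω
              - v (⌈Real.sqrt Λ0 / (Real.sqrt Λ1 * ε)⌉₊) ω‖ ^ 2))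
        ≤ 2 * Λ1 * ε ^ 2) := by
  have hMpos : 0 < M := by rw [hM]; positivity
  have hx : M * η 0 ^ 2 ≤ 1 / 3 := by
    have h3 : (0 : ℝ) < Real.sqrt 3 := by positivity
    have hsq : Real.sqrt 3 ^ 2 = 3 := Real.sq_sqrt (by norm_num)
    calc M * η 0 ^ 2 ≤ M * (1 / (3 * Real.sqrt 3 * L)) ^ 2 := by gcongr
      _ = 1 / 3 := by
        rw [hM, div_pow, mul_pow, mul_pow, hsq]; field_simp; norm_num
  obtain ⟨hlow, hηb⟩ := esh_eta M hMpos η hη0pos hx hηrec ηlow hηlow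
  set X : ℕ → ℝ := fun j => ∫ ω, ‖F (v j ω) - Ftv j ω‖ ^ 2 with hX
  have main : ∀ k : ℕ, (∫ ω, (‖F (u k ω)‖ ^ 2 + 2 * L ^ 2 * ‖u k ω - v k ω‖ ^ 2))
        ≤ Λ0 / (((k : ℝ) + 1) * ((k : ℝ) + 2)) + Λ1 * ε ^ 2 := by
    intro k
    have hk : (0 : ℝ) ≤ k := Nat.cast_nonneg k
    have hpath : ∀ ω, ‖F (u k ω)‖ ^ 2 + 2 * L ^ 2 * ‖u k ω - v k ω‖ ^ 2 ≤
        Λ0 / (((k : ℝ) + 1) * ((k : ℝ) + 2))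
        + 4 / (((k : ℝ) + 1) * ((k : ℝ) + 2) * ηlow) * ∑ i ∈ Finset.range k,
        (((i : ℝ) + 1) * ((i : ℝ) + 2) * (2 / 3 * η 0) * ‖F (v i ω) - Ftv i ω‖ ^ 2
        + ((i : ℝ) + 1) * ((i : ℝ) + 2) * (1 / (M * ηlow)) *
          ‖F (v (i + 1) ω) - Ftv (i + 1) ω‖ ^ 2) := by
      intro ω
      rw [hΛ0]
      have e1 : ∀ j : ℕ, (j : ℝ) + 1 + 1 = j + 2 := fun j => by ring
      refine esh_path L M hL hM η ηlow hlow hηb hx hηrec F hmono hlip ustar hstar u0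
        (fun j => u j ω) (fun j => v j ω) (fun j => Ftv j ω) (hu0 ω) (hv0 ω) ?_ ?_ k
      · intro j
        have := hvrec (j + 1) (by omega) ω
        push_cast at this
        rw [e1] at this
        simpa using this
      · intro j
        have := hurec (j + 1) (by omega) ω
        push_cast at this
        rw [e1] at this
        simpa using this
    have hi1 : ∀ i ∈ Finset.range k, Integrable (fun ω =>
        ((i : ℝ) + 1) * ((i : ℝ) + 2) * (2 / 3 * η 0) * ‖F (v i ω) - Ftv i ω‖ ^ 2
        + ((i : ℝ) + 1) * ((i : ℝ) + 2) * (1 / (M * ηlow)) *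
          ‖F (v (i + 1) ω) - Ftv (i + 1) ω‖ ^ 2) := fun i _ =>
      ((hintErr i).const_mul _).add ((hintErr (i + 1)).const_mul _)
    have hi2 := (integrable_finsetSum _ hi1).const_mul (4 / (((k : ℝ) + 1) * ((k : ℝ) + 2) * ηlow))
    have hle := integral_mono (hintF k) ((integrable_const _).add hi2) hpath
    refine hle.trans ?_
    simp only [Pi.add_apply]
    rw [integral_add (integrable_const _) hi2, integral_const, integral_const_mul,
      integral_finsetSum _ hi1]
    simp only [probReal_univ, one_smul]
    have hsum : ∑ i ∈ Finset.range k, ∫ ω, (((i : ℝ) + 1) * ((i : ℝ) + 2) * (2 / 3 * η 0) * ‖F (v i ω) - Ftv i ω‖ ^ 2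
        + ((i : ℝ) + 1) * ((i : ℝ) + 2) * (1 / (M * ηlow)) *
          ‖F (v (i + 1) ω) - Ftv (i + 1) ω‖ ^ 2)
        = 2 / 3 * η 0 * (∑ i ∈ Finset.range k, ((i : ℝ) + 1) * ((i : ℝ) + 2) * X i)
        + 1 / (M * ηlow) * ∑ i ∈ Finset.range k, ((i : ℝ) + 1) * ((i : ℝ) + 2) * X (i + 1) := by
      rw [Finset.mul_sum, Finset.mul_sum, ← Finset.sum_add_distrib]
      refine Finset.sum_congr rfl fun i _ => ?_
      rw [integral_add ((hintErr i).const_mul _) ((hintErr (i + 1)).const_mul _),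
        integral_const_mul, integral_const_mul]
      simp only [hX]
      ring
    rw [hsum]
    have s1 := esh_sum1 (ε ^ 2) (by positivity) X herr01 herr k
    have s2 := esh_sum2 (ε ^ 2) (by positivity) X herr01 herr k
    have hb : 4 / (((k : ℝ) + 1) * ((k : ℝ) + 2) * ηlow) *
        (2 / 3 * η 0 * (∑ i ∈ Finset.range k, ((i : ℝ) + 1) * ((i : ℝ) + 2) * X i)
        + 1 / (M * ηlow) * ∑ i ∈ Finset.range k, ((i : ℝ) + 1) * ((i : ℝ) + 2) * X (i + 1))
        ≤ 4 / (((k : ℝ) + 1) * ((k : ℝ) + 2) * ηlow) *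
        (2 / 3 * η 0 * (15 / 8 * (((k : ℝ) + 1) * ((k : ℝ) + 2)) * ε ^ 2)
        + 1 / (M * ηlow) * (5 / 4 * (((k : ℝ) + 1) * ((k : ℝ) + 2)) * ε ^ 2)) := by
      gcongr
    have he : 4 / (((k : ℝ) + 1) * ((k : ℝ) + 2) * ηlow) *
        (2 / 3 * η 0 * (15 / 8 * (((k : ℝ) + 1) * ((k : ℝ) + 2)) * ε ^ 2)
        + 1 / (M * ηlow) * (5 / 4 * (((k : ℝ) + 1) * ((k : ℝ) + 2)) * ε ^ 2)) = Λ1 * ε ^ 2 := by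
      rw [hΛ1]; field_simp; ring
    linarith
  refine ⟨fun k _ => main k, ?_⟩
  set N := ⌈Real.sqrt Λ0 / (Real.sqrt Λ1 * ε)⌉₊ with hN
  have hΛ1pos : 0 < Λ1 := by rw [hΛ1]; positivity
  have hΛ0nn : 0 ≤ Λ0 := by rw [hΛ0]; positivity
  have hNle : Real.sqrt Λ0 / (Real.sqrt Λ1 * ε) ≤ N := Nat.le_ceil _
  have hs1 : 0 < Real.sqrt Λ1 := Real.sqrt_pos.2 hΛ1pos
  rw [div_le_iff₀ (by positivity)] at hNle
  have hΛ : Λ0 ≤ (N : ℝ) ^ 2 * (Λ1 * ε ^ 2) := by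
    have h1 : Real.sqrt Λ0 ^ 2 ≤ (N * (Real.sqrt Λ1 * ε)) ^ 2 := by gcongr
    rw [mul_pow, mul_pow, Real.sq_sqrt hΛ0nn, Real.sq_sqrt hΛ1pos.le] at h1
    exact h1
  have hNn : (0 : ℝ) ≤ N := Nat.cast_nonneg N
  have hdiv : Λ0 / (((N : ℝ) + 1) * ((N : ℝ) + 2)) ≤ Λ1 * ε ^ 2 := by
    rw [div_le_iff₀ (by positivity)]
    have : 0 < Λ1 * ε ^ 2 := by positivity
    nlinarith
  have := main N
  linarith
end

section
/- Fix u_0 ∈ ℝ^d, L > 0, and vectors g_0, g_1, g_2, … in ℝ^d, and define the Halpern iterates u_k = (1/(k+1)) u_0 + (k/(k+1))(u_{k-1} − (1/L) g_{k-1}) for k ≥ 1. Then ‖u_1 − u_0‖² = (1/(4L²))‖g_0‖², and for every k ≥ 2, ‖u_k − u_{k-1}‖² ≤ (2k²/(L²(k+1)²)) ‖g_{k-1}‖² + Σ_{i=0}^{k-2} (2(i+1)²/(k(k+1)² L²)) ‖g_i‖². -/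
/-- Deterministic bound on the distance between consecutive Halpern iterates
`u_k = (1/(k+1)) u_0 + (k/(k+1)) (u_{k-1} − (1/L) g_{k-1})`. -/
theorem halpern_consecutive_iterate_distance
    {d : ℕ} (u0 : EuclideanSpace ℝ (Fin d)) (L : ℝ) (hL : 0 < L)
    (g : ℕ → EuclideanSpace ℝ (Fin d)) (u : ℕ → EuclideanSpace ℝ (Fin d))
    (hu0 : u 0 = u0)
    (hrec : ∀ k : ℕ, 1 ≤ k →
      u k = ((1 : ℝ) / ((k : ℝ) + 1)) • u0
        + (((k : ℝ)) / ((k : ℝ) + 1)) • (u (k - 1) - (1 / L) • g (k - 1))) :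
    ‖u 1 - u 0‖ ^ 2 = (1 / (4 * L ^ 2)) * ‖g 0‖ ^ 2 ∧
      ∀ k : ℕ, 2 ≤ k →
        ‖u k - u (k - 1)‖ ^ 2 ≤
          (2 * (k : ℝ) ^ 2 / (L ^ 2 * ((k : ℝ) + 1) ^ 2)) * ‖g (k - 1)‖ ^ 2 +
            ∑ i ∈ Finset.range (k - 1),
              (2 * ((i : ℝ) + 1) ^ 2 / ((k : ℝ) * ((k : ℝ) + 1) ^ 2 * L ^ 2)) * ‖g i‖ ^ 2 := by
  have hS : ∀ m : ℕ, u m - u 0 =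
      (-(1 / (((m : ℝ) + 1) * L))) • ∑ i ∈ Finset.range m, ((i : ℝ) + 1) • g i := by
    intro m
    induction m with
    | zero => simp
    | succ m ih =>
      have h := hrec (m + 1) (by omega)
      rw [Nat.add_sub_cancel] at h
      have hm : (m : ℝ) + 1 ≠ 0 := by positivity
      have hm2 : (m : ℝ) + 1 + 1 ≠ 0 := by positivity
      have e : u m = u 0 + (-(1 / (((m : ℝ) + 1) * L))) •
          ∑ i ∈ Finset.range m, ((i : ℝ) + 1) • g i := by rw [← ih]; abel
      rw [h, e, Finset.sum_range_succ, ← hu0]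
      push_cast
      match_scalars <;> field_simp <;> ring
  have hD : ∀ m : ℕ, u (m + 1) - u m = (1 / (((m : ℝ) + 1 + 1) * L)) •
      ((1 / ((m : ℝ) + 1)) • (∑ i ∈ Finset.range m, ((i : ℝ) + 1) • g i)
        - ((m : ℝ) + 1) • g m) := by
    intro m
    have hm : (m : ℝ) + 1 ≠ 0 := by positivity
    have hm2 : (m : ℝ) + 1 + 1 ≠ 0 := by positivity
    have e : u (m + 1) - u m = (u (m + 1) - u 0) - (u m - u 0) := by abel
    rw [e, hS, hS, Finset.sum_range_succ]
    push_cast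
    match_scalars <;> field_simp <;> ring
  constructor
  · have h := hD 0
    simp only [zero_add] at h
    rw [h, norm_smul, mul_pow, Real.norm_eq_abs, sq_abs]
    simp
    left
    ring
  · intro k hk
    obtain ⟨m, rfl⟩ : ∃ m, k = m + 1 := ⟨k - 1, by omega⟩
    rw [Nat.add_sub_cancel, hD, norm_smul, mul_pow, Real.norm_eq_abs, sq_abs]
    push_cast
    set S := ∑ i ∈ Finset.range m, ((i : ℝ) + 1) • g i with hSdef
    set T := ∑ i ∈ Finset.range m, ((i : ℝ) + 1) ^ 2 * ‖g i‖ ^ 2 with hT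
    have hT0 : 0 ≤ T := Finset.sum_nonneg fun i _ => by positivity
    have hST : ‖S‖ ^ 2 ≤ m * T := by
      have h1 : ‖S‖ ≤ ∑ i ∈ Finset.range m, ((i : ℝ) + 1) * ‖g i‖ := by
        refine (norm_sum_le _ _).trans (Finset.sum_le_sum fun i _ => ?_)
        rw [norm_smul, Real.norm_of_nonneg (by positivity)]
      have h2 := sq_sum_le_card_mul_sum_sq (s := Finset.range m)
        (f := fun i : ℕ => ((i : ℝ) + 1) * ‖g i‖)
      simp only [mul_pow, Finset.card_range] at h2
      exact (pow_le_pow_left₀ (norm_nonneg _) h1 2).trans h2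
    have hsum : ∑ i ∈ Finset.range m, (2 * ((i : ℝ) + 1) ^ 2 /
        (((m : ℝ) + 1) * ((m : ℝ) + 1 + 1) ^ 2 * L ^ 2)) * ‖g i‖ ^ 2
        = (1 / (((m : ℝ) + 1 + 1) * L)) ^ 2 * (2 * (T / ((m : ℝ) + 1))) := by
      rw [hT, Finset.sum_div, Finset.mul_sum, Finset.mul_sum]
      refine Finset.sum_congr rfl fun i _ => ?_
      field_simp
    have hfirst : (2 * ((m : ℝ) + 1) ^ 2 / (L ^ 2 * ((m : ℝ) + 1 + 1) ^ 2)) * ‖g m‖ ^ 2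
        = (1 / (((m : ℝ) + 1 + 1) * L)) ^ 2 * (2 * (((m : ℝ) + 1) * ‖g m‖) ^ 2) := by
      field_simp
    rw [hsum, hfirst, ← mul_add]
    refine mul_le_mul_of_nonneg_left ?_ (by positivity)
    have h3 := norm_sub_le ((1 / ((m : ℝ) + 1)) • S) (((m : ℝ) + 1) • g m)
    rw [norm_smul, norm_smul, Real.norm_of_nonneg (by positivity : (0 : ℝ) ≤ 1 / ((m : ℝ) + 1)),
      Real.norm_of_nonneg (by positivity : (0 : ℝ) ≤ (m : ℝ) + 1)] at h3
    have h4 : (1 / ((m : ℝ) + 1) * ‖S‖) ^ 2 ≤ T / ((m : ℝ) + 1) := by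
      rw [mul_pow, div_pow, one_pow, one_div_mul_eq_div, div_le_div_iff₀ (by positivity) (by positivity)]
      nlinarith [mul_nonneg hT0 (by positivity : (0 : ℝ) ≤ (m : ℝ) + 1)]
    have h5 := pow_le_pow_left₀ (norm_nonneg _) h3 2
    nlinarith [sq_nonneg (1 / ((m : ℝ) + 1) * ‖S‖ - ((m : ℝ) + 1) * ‖g m‖)]
end

section
/- There is a universal constant C with the following property. Let F : ℝ^d → ℝ^d be (1/L)-cocoercive with zero u*, let random iterates satisfy u_j = (1/(j+1)) u_0 + (j/(j+1))(u_{j-1} − (1/L) F̃(u_{j-1})) for j ≥ 1 with integrable random estimates F̃(u_j), fix k ≥ 2 and ε > 0, and set Λ₀ = 76 L ‖u_0 − u*‖ and Λ₁ = 4√(2/3). If (i) E[‖F(u_i)‖] ≤ Λ₀/i + Λ₁ ε for all 1 ≤ i ≤ k−1, (ii) E[‖F(u_i) − F̃(u_i)‖²] ≤ ε²/i for all 1 ≤ i ≤ k−1 and E[‖F(u_0) − F̃(u_0)‖²] ≤ ε²/8, and (iii) ε ≤ Λ₀/k, then E[‖u_k − u_{k-1}‖²] ≤ C ‖u_0 −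 u*‖² / k². -/
open MeasureTheory
open scoped RealInnerProductSpace

section aux
variable {E : Type*} [NormedAddCommGroup E] [InnerProductSpace ℝ E]

lemma aux_pot (j k : ℝ) (hj : 0 < j) (hk : 0 < k) (y y' g g' δ : E)
    (h : (j + 1) • y' = j • (y - g + δ))
    (hc : ‖g' - g‖ ^ 2 ≤ ⟪g' - g, y' - y⟫) :
    (j + 1) * ⟪g', y'⟫ + j * (j + 1) / 2 * ‖g'‖ ^ 2 ≤
      j * ⟪g, y⟫ + (j - 1) * j / 2 * ‖g‖ ^ 2
        + (j * (j + 1) / 2 + 2 * k) * ‖δ‖ ^ 2 + j ^ 2 / (8 * k) * ‖g‖ ^ 2 := by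
  have h1 := congrArg (fun v => ⟪g', v⟫) h
  have h2 := congrArg (fun v => ⟪g, v⟫) h
  simp only [inner_smul_right, inner_add_right, inner_sub_right] at h1 h2
  have s1 : 0 ≤ ‖g' - g - δ‖ ^ 2 := by positivity
  have s2 : 0 ≤ ‖j • g - (4 * k) • δ‖ ^ 2 := by positivity
  simp only [← real_inner_self_eq_norm_sq, inner_smul_right, inner_sub_right,
    inner_smul_left, inner_sub_left] at *
  simp only [conj_trivial] at *
  rw [real_inner_comm g' g, real_inner_comm g' δ, real_inner_comm g δ] at s1
  rw [real_inner_comm g' g] at hc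
  rw [real_inner_comm g δ] at s2
  have s3 : 0 ≤ j ^ 2 / (8 * k) * ⟪g, g⟫ - j * ⟪g, δ⟫ + 2 * k * ⟪δ, δ⟫ := by
    have : j ^ 2 / (8 * k) * ⟪g, g⟫ - j * ⟪g, δ⟫ + 2 * k * ⟪δ, δ⟫
      = (j ^ 2 * ⟪g, g⟫ - 8 * k * j * ⟪g, δ⟫ + 16 * k ^ 2 * ⟪δ, δ⟫) / (8 * k) := by
      field_simp; ring
    rw [this]
    apply div_nonneg _ (by positivity)
    linarith
  have c1 := mul_le_mul_of_nonneg_left hc (show 0 ≤ j * (j + 1) by positivity)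
  have c2 := mul_nonneg (show 0 ≤ j * (j + 1) / 2 by positivity) s1
  have e1 := congrArg (fun v => (j + 1) * v) h1
  have e2 := congrArg (fun v => j * v) h2
  simp only [real_inner_comm] at *
  linarith

lemma aux_dist (j : ℝ) (hj : 0 < j) (x x' u0 us g δ : E)
    (h : (j + 1) • (x' - u0) = j • (x - u0 - g + δ))
    (hc : ‖g‖ ^ 2 ≤ ⟪g, x - us⟫) :
    (j + 1) * ‖x' - us‖ ^ 2 ≤ ‖u0 - us‖ ^ 2 + (j + 1 / 2) * ‖x - us‖ ^ 2
        + j * (2 * j + 1) * ‖δ‖ ^ 2 := by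
  obtain ⟨z, hz⟩ : ∃ z, z = x - us - g := ⟨_, rfl⟩
  obtain ⟨p, hp⟩ : ∃ p, p = u0 - us := ⟨_, rfl⟩
  have hzn : ‖z‖ ^ 2 ≤ ‖x - us‖ ^ 2 := by
    rw [hz, norm_sub_sq_real, real_inner_comm]
    nlinarith [sq_nonneg ‖g‖]
  have hq : (j + 1) • (x' - us) = p + j • (z + δ) := by
    have : (j + 1) • (x' - us) = (j + 1) • (x' - u0) + (j + 1) • p := by
      rw [← smul_add, hp]; congr 1; abel
    rw [this, h, hz, hp]; module
  have n1 := congrArg (fun v => ‖v‖ ^ 2) hq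
  simp only [norm_smul, mul_pow, Real.norm_eq_abs, sq_abs] at n1
  have s1 : 0 ≤ ‖p - (z + δ)‖ ^ 2 := by positivity
  have s2 : 0 ≤ ‖z - (2 * j) • δ‖ ^ 2 := by positivity
  rw [norm_sub_sq_real] at s1 s2
  rw [norm_add_sq_real, norm_smul, inner_smul_right, mul_pow, Real.norm_eq_abs, sq_abs] at n1
  rw [norm_smul, inner_smul_right, mul_pow, Real.norm_eq_abs, sq_abs] at s2
  have s3 := norm_add_sq_real z δ
  rw [← hp]
  have t1 : (j + 1) * ‖x' - us‖ ^ 2 ≤ ‖p‖ ^ 2 + j * ‖z + δ‖ ^ 2 := by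
    have := mul_nonneg hj.le s1
    refine le_of_mul_le_mul_left (a := j + 1) ?_ (by positivity)
    linarith
  have t2 : j * ‖z + δ‖ ^ 2 ≤ (j + 1 / 2) * ‖z‖ ^ 2 + j * (2 * j + 1) * ‖δ‖ ^ 2 := by
    rw [s3]; linarith
  have t3 := mul_le_mul_of_nonneg_left hzn (show 0 ≤ j + 1 / 2 by positivity)
  linarith

lemma aux_low (j : ℝ) (hj : 1 ≤ j) (x u0 us g : E) (hc : ‖g‖ ^ 2 ≤ ⟪g, x - us⟫) :
    j ^ 2 / 4 * ‖g‖ ^ 2 - ‖u0 - us‖ ^ 2 ≤ j * ⟪g, x - u0⟫ + (j - 1) * j / 2 * ‖g‖ ^ 2 := by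
  have h1 : ⟪g, x - u0⟫ = ⟪g, x - us⟫ - ⟪g, u0 - us⟫ := by
    rw [← inner_sub_right]; congr 1; abel
  have h2 := real_inner_le_norm g (u0 - us)
  have h3 := mul_le_mul_of_nonneg_left hc (show 0 ≤ j by positivity)
  have h4 := mul_le_mul_of_nonneg_left h2 (show 0 ≤ j by positivity)
  rw [h1]
  nlinarith [sq_nonneg (j * ‖g‖ / 2 - ‖u0 - us‖), mul_nonneg (show 0 ≤ j by positivity) (sq_nonneg ‖g‖)]

lemma aux_fin (j : ℝ) (hj : 0 < j) (x x' u0 us g δ : E)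
    (h : (j + 1) • (x' - u0) = j • (x - u0 - g + δ)) :
    (j + 1) ^ 2 * ‖x' - x‖ ^ 2 ≤ 6 * ‖x - us‖ ^ 2 + 6 * ‖u0 - us‖ ^ 2
      + 3 * (j ^ 2 * ‖g‖ ^ 2) + 3 * (j ^ 2 * ‖δ‖ ^ 2) := by
  have hq : (j + 1) • (x' - x) = (u0 - us) - (x - us) + (j • δ - j • g) := by
    have : (j + 1) • (x' - x) = (j + 1) • (x' - u0) - (j + 1) • (x - u0) := by
      rw [← smul_sub]; congr 1; abel
    rw [this, h]; module
  have n1 := congrArg (fun v => ‖v‖) hq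
  simp only [norm_smul, Real.norm_eq_abs] at n1
  rw [abs_of_pos (by positivity)] at n1
  have n2 : (j + 1) * ‖x' - x‖ ≤ ‖u0 - us‖ + ‖x - us‖ + (j * ‖δ‖ + j * ‖g‖) := by
    rw [n1]
    refine (norm_add_le _ _).trans (add_le_add (norm_sub_le _ _) ((norm_sub_le _ _).trans ?_))
    simp [norm_smul, abs_of_pos hj]
  have n3 := pow_le_pow_left₀ (by positivity) n2 2
  rw [mul_pow] at n3
  refine n3.trans ?_
  generalize ‖u0 - us‖ = a, ‖x - us‖ = b
  rw [← mul_pow, ← mul_pow]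
  generalize j * ‖δ‖ = c, j * ‖g‖ = d
  nlinarith [sq_nonneg (a - b), sq_nonneg (c - d), sq_nonneg (2 * a - c), sq_nonneg (2 * a - d),
    sq_nonneg (2 * b - c), sq_nonneg (2 * b - d)]

lemma aux_int {Ω : Type*} [MeasurableSpace Ω] (μ : Measure Ω) [IsProbabilityMeasure μ]
    {f1 f2 h1 h2 h3 h4 : Ω → ℝ} (a1 a2 c b1 b2 b3 b4 : ℝ)
    (if1 : Integrable f1 μ) (if2 : Integrable f2 μ) (ih1 : Integrable h1 μ)
    (ih2 : Integrable h2 μ) (ih3 : Integrable h3 μ) (ih4 : Integrable h4 μ)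
    (h : ∀ ω, a1 * f1 ω + a2 * f2 ω ≤ c + b1 * h1 ω + b2 * h2 ω + b3 * h3 ω + b4 * h4 ω) :
    a1 * (∫ ω, f1 ω ∂μ) + a2 * (∫ ω, f2 ω ∂μ) ≤
      c + b1 * (∫ ω, h1 ω ∂μ) + b2 * (∫ ω, h2 ω ∂μ) + b3 * (∫ ω, h3 ω ∂μ)
        + b4 * (∫ ω, h4 ω ∂μ) := by
  have key := integral_mono (μ := μ) (f := fun ω => a1 * f1 ω + a2 * f2 ω)
    (g := fun ω => c + b1 * h1 ω + b2 * h2 ω + b3 * h3 ω + b4 * h4 ω)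
    (by fun_prop) (by fun_prop) h
  rw [integral_add (by fun_prop) (by fun_prop), integral_add (by fun_prop) (by fun_prop),
    integral_add (by fun_prop) (by fun_prop), integral_add (by fun_prop) (by fun_prop),
    integral_add (by fun_prop) (by fun_prop)] at key
  simpa only [integral_const_mul, integral_const, probReal_univ, one_smul] using key

lemma aux_main {Ω : Type*} [MeasurableSpace Ω] (μ : Measure Ω) [IsProbabilityMeasure μ]
    (u0 us : E) (x g δ : ℕ → Ω → E) (k : ℕ) (hk : 2 ≤ k)
    (hx : ∀ j, MemLp (x j) 2 μ) (hg : ∀ j, MemLp (g j) 2 μ) (hd : ∀ j, MemLp (δ j) 2 μ)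
    (hx0 : ∀ ω, x 0 ω = u0)
    (hrec : ∀ (n : ℕ) ω, ((n : ℝ) + 1 + 1) • (x (n + 1) ω - u0)
      = ((n : ℝ) + 1) • (x n ω - u0 - g n ω + δ n ω))
    (hc : ∀ (n : ℕ) ω, ‖g (n + 1) ω - g n ω‖ ^ 2 ≤ ⟪g (n + 1) ω - g n ω, x (n + 1) ω - x n ω⟫)
    (hs : ∀ (n : ℕ) ω, ‖g n ω‖ ^ 2 ≤ ⟪g n ω, x n ω - us⟫)
    (hD : ∀ n : ℕ, n + 1 ≤ k →
      ((n : ℝ) + 1) * (k : ℝ) ^ 2 * ∫ ω, ‖δ n ω‖ ^ 2 ∂μ ≤ 2 * 5776 * ‖u0 - us‖ ^ 2) :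
    ∫ ω, ‖x k ω - x (k - 1) ω‖ ^ 2 ∂μ ≤ 10000000 * ‖u0 - us‖ ^ 2 / (k : ℝ) ^ 2 := by
  have hk0 : (2 : ℝ) ≤ k := by exact_mod_cast hk
  have ig : ∀ j, Integrable (fun ω => ‖g j ω‖ ^ 2) μ := fun j => (hg j).integrable_norm_pow two_ne_zero
  have id : ∀ j, Integrable (fun ω => ‖δ j ω‖ ^ 2) μ := fun j => (hd j).integrable_norm_pow two_ne_zero
  have ix : ∀ j, Integrable (fun ω => ‖x j ω - us‖ ^ 2) μ := fun j =>
    ((hx j).sub (memLp_const us)).integrable_norm_pow two_ne_zero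
  have ixx : ∀ i j, Integrable (fun ω => ‖x i ω - x j ω‖ ^ 2) μ := fun i j =>
    ((hx i).sub (hx j)).integrable_norm_pow two_ne_zero
  have ii : ∀ j, Integrable (fun ω => ⟪g j ω, x j ω - u0⟫) μ := by
    intro j
    have hy : MemLp (fun ω => x j ω - u0) 2 μ := (hx j).sub (memLp_const u0)
    refine ((ig j).add (hy.integrable_norm_pow two_ne_zero)).mono'
      ((hg j).aestronglyMeasurable.inner hy.aestronglyMeasurable)
      (Filter.Eventually.of_forall fun ω => ?_)
    refine (norm_inner_le_norm _ _).trans ?_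
    simp only [Pi.add_apply]
    nlinarith [sq_nonneg (‖g j ω‖ - ‖x j ω - u0‖), sq_nonneg (‖g j ω‖ + ‖x j ω - u0‖)]
  set D := ‖u0 - us‖ ^ 2 with hDdef
  have D0 : 0 ≤ D := by positivity
  -- distance
  have hB : ∀ n : ℕ, n + 1 ≤ k → ∫ ω, ‖x n ω - us‖ ^ 2 ∂μ ≤ (2 + 12 * 5776) * D := by
    intro n
    induction n with
    | zero => intro _; simp only [hx0, integral_const, probReal_univ, one_smul]; linarith
    | succ n ih =>
      intro hn
      have h1 := ih (by omega)
      have h2 := hD n (by omega)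
      have hn' : (n : ℝ) + 1 + 1 ≤ k := by exact_mod_cast hn
      have hp : (0 : ℝ) < (n : ℝ) + 1 := by positivity
      have key := aux_int μ ((n : ℝ) + 1 + 1) 0 D ((n : ℝ) + 1 + 1 / 2)
        (((n : ℝ) + 1) * (2 * ((n : ℝ) + 1) + 1)) 0 0
        (ix (n+1)) (ix n) (ix n) (id n) (id n) (id n) (fun ω => by
          have := aux_dist _ hp _ _ _ _ _ _ (hrec n ω) (hs n ω)
          linarith)
      have hΔ : ((n : ℝ) + 1) * (2 * ((n : ℝ) + 1) + 1) * ∫ ω, ‖δ n ω‖ ^ 2 ∂μ ≤ 6 * 5776 * D := by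
        have e : ((n : ℝ) + 1) * ∫ ω, ‖δ n ω‖ ^ 2 ∂μ ≤ 2 * 5776 * D / (k : ℝ) ^ 2 := by
          rw [le_div_iff₀ (by positivity)]; linarith
        have e2 := mul_le_mul_of_nonneg_left e (show (0 : ℝ) ≤ 2 * ((n : ℝ) + 1) + 1 by positivity)
        have e3 : (2 * ((n : ℝ) + 1) + 1) * (2 * 5776 * D / (k : ℝ) ^ 2) ≤ 6 * 5776 * D := by
          rw [← mul_div_assoc, div_le_iff₀ (by positivity)]
          have : 2 * ((n : ℝ) + 1) + 1 ≤ 3 * (k : ℝ) ^ 2 := by nlinarith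
          nlinarith [mul_le_mul_of_nonneg_right this D0]
        linarith
      have h3 := mul_le_mul_of_nonneg_left h1 (show (0 : ℝ) ≤ (n : ℝ) + 1 + 1 / 2 by positivity)
      refine le_of_mul_le_mul_left (a := (n : ℝ) + 1 + 1) ?_ (by positivity)
      linarith
  -- potential
  have hlow : ∀ n : ℕ, ((n : ℝ) + 1) ^ 2 / 4 * ∫ ω, ‖g n ω‖ ^ 2 ∂μ - D ≤
      ((n : ℝ) + 1) * (∫ ω, ⟪g n ω, x n ω - u0⟫ ∂μ)
        + ((n : ℝ) + 1 - 1) * ((n : ℝ) + 1) / 2 * ∫ ω, ‖g n ω‖ ^ 2 ∂μ := by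
    intro n
    have key := aux_int μ (((n : ℝ) + 1) ^ 2 / 4) 0 D ((n : ℝ) + 1)
      (((n : ℝ) + 1 - 1) * ((n : ℝ) + 1) / 2) 0 0 (ig n) (ig n) (ii n) (ig n) (ig n) (ig n)
      (fun ω => by
        have := aux_low ((n : ℝ) + 1) (by simp) _ u0 us _ (hs n ω)
        linarith)
    linarith
  have hC : ∀ n : ℕ, n + 1 ≤ k → ((n : ℝ) + 1) * (∫ ω, ⟪g n ω, x n ω - u0⟫ ∂μ)
        + ((n : ℝ) + 1 - 1) * ((n : ℝ) + 1) / 2 * ∫ ω, ‖g n ω‖ ^ 2 ∂μ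
        ≤ n / k * ((1 + 10 * 5776) * D) := by
    intro n
    induction n with
    | zero => intro _; simp [hx0]
    | succ n ih =>
      intro hn
      have h1 := ih (by omega)
      have h2 := hD n (by omega)
      have h0 := hlow n
      have hn' : (n : ℝ) + 1 + 1 ≤ k := by exact_mod_cast hn
      have hp : (0 : ℝ) < (n : ℝ) + 1 := by positivity
      have hkp : (0 : ℝ) < k := by linarith
      have key := aux_int μ ((n : ℝ) + 1 + 1) (((n : ℝ) + 1) * ((n : ℝ) + 1 + 1) / 2) 0
        ((n : ℝ) + 1) (((n : ℝ) + 1 - 1) * ((n : ℝ) + 1) / 2)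
        (((n : ℝ) + 1) * ((n : ℝ) + 1 + 1) / 2 + 2 * k) (((n : ℝ) + 1) ^ 2 / (8 * k))
        (ii (n+1)) (ig (n+1)) (ii n) (ig n) (id n) (ig n)
        (fun ω => by
          have := aux_pot _ k hp hkp _ _ _ _ _ (hrec n ω) (by
            have := hc n ω
            rwa [sub_sub_sub_cancel_right])
          linarith)
      have hfr : (n : ℝ) / k * ((1 + 10 * 5776) * D) ≤ (1 + 10 * 5776) * D := by
        have : (n : ℝ) / k ≤ 1 := by rw [div_le_one hkp]; linarith
        exact mul_le_of_le_one_left (by positivity) this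
      have hG : ((n : ℝ) + 1) ^ 2 / (8 * k) * ∫ ω, ‖g n ω‖ ^ 2 ∂μ ≤ (1 + 5 * 5776) * D / k := by
        have : ((n : ℝ) + 1) ^ 2 / (8 * k) * ∫ ω, ‖g n ω‖ ^ 2 ∂μ
          = (((n : ℝ) + 1) ^ 2 / 4 * ∫ ω, ‖g n ω‖ ^ 2 ∂μ) / 2 / k := by ring
        rw [this]
        gcongr
        linarith
      have hΔ : (((n : ℝ) + 1) * ((n : ℝ) + 1 + 1) / 2 + 2 * k) * ∫ ω, ‖δ n ω‖ ^ 2 ∂μ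
          ≤ 5 * 5776 * D / k := by
        have e : ∫ ω, ‖δ n ω‖ ^ 2 ∂μ ≤ 2 * 5776 * D / (((n : ℝ) + 1) * (k : ℝ) ^ 2) := by
          rw [le_div_iff₀ (by positivity)]; linarith
        have e2 := mul_le_mul_of_nonneg_left e
          (show (0 : ℝ) ≤ ((n : ℝ) + 1) * ((n : ℝ) + 1 + 1) / 2 + 2 * k by positivity)
        refine e2.trans ?_
        rw [← mul_div_assoc, div_le_div_iff₀ (by positivity) (by positivity)]
        have : (((n : ℝ) + 1) * ((n : ℝ) + 1 + 1) / 2 + 2 * k) * 2 ≤ 5 * (((n : ℝ) + 1) * k) := by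
          nlinarith
        have := mul_le_mul_of_nonneg_right this (show 0 ≤ 5776 * D * k by positivity)
        linarith
      have hsum : ((n + 1 : ℕ) : ℝ) / k * ((1 + 10 * 5776) * D)
          = (n : ℝ) / k * ((1 + 10 * 5776) * D) + 5 * 5776 * D / k + (1 + 5 * 5776) * D / k := by
        push_cast; ring
      rw [hsum]
      push_cast
      rw [add_sub_cancel_right ((n : ℝ) + 1) 1]
      linarith
  obtain ⟨m, rfl⟩ : ∃ m, k = m + 1 := ⟨k - 1, by omega⟩
  have hp : (0 : ℝ) < (m : ℝ) + 1 := by positivity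
  have key := aux_int μ (((m : ℝ) + 1 + 1) ^ 2) 0 (6 * D) 6 (3 * ((m : ℝ) + 1) ^ 2)
    (3 * ((m : ℝ) + 1) ^ 2) 0 (ixx (m + 1) m) (ig m) (ix m) (ig m) (id m) (ig m)
    (fun ω => by
      have := aux_fin _ hp _ _ _ us _ _ (hrec m ω)
      linarith)
  have h1 := hB m le_rfl
  have h2 := hlow m
  have h3 := hC m le_rfl
  have h4 := hD m le_rfl
  have hfr : (m : ℝ) / ((m + 1 : ℕ) : ℝ) * ((1 + 10 * 5776) * D) ≤ (1 + 10 * 5776) * D := by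
    have : (m : ℝ) / ((m + 1 : ℕ) : ℝ) ≤ 1 := by
      rw [div_le_one (by push_cast; positivity)]; push_cast; linarith
    exact mul_le_of_le_one_left (by positivity) this
  push_cast at h4 ⊢
  rw [le_div_iff₀ (by positivity)]
  have i0 : 0 ≤ ∫ ω, ‖δ m ω‖ ^ 2 ∂μ := integral_nonneg fun _ => by positivity
  have i1 : 0 ≤ ∫ ω, ‖x (m + 1) ω - x m ω‖ ^ 2 ∂μ := integral_nonneg fun _ => by positivity
  have h5 : ((m : ℝ) + 1) ^ 2 * ∫ ω, ‖δ m ω‖ ^ 2 ∂μ ≤ 2 * 5776 * D := by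
    refine le_trans ?_ h4
    apply mul_le_mul_of_nonneg_right _ i0
    nlinarith [sq_nonneg ((m : ℝ) + 1), (Nat.cast_nonneg m : (0 : ℝ) ≤ m)]
  have h6 : (∫ ω, ‖x (m + 1) ω - x m ω‖ ^ 2 ∂μ) * ((m : ℝ) + 1) ^ 2
      ≤ ((m : ℝ) + 1 + 1) ^ 2 * ∫ ω, ‖x (m + 1) ω - x m ω‖ ^ 2 ∂μ := by
    rw [mul_comm]
    apply mul_le_mul_of_nonneg_right _ i1
    nlinarith
  linarith
end aux

/-- There is a universal constant `C` such that, for the stochastic Halpern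
iteration with a `(1/L)`-cocoercive operator, if the expected operator norms and estimator
errors are under control up to iteration `k − 1` and `ε ≤ Λ₀/k`, then
`E[‖u_k − u_{k-1}‖²] ≤ C ‖u_0 − u*‖²/k²`. -/
theorem stochastic_halpern_iterate_distance_bound :
    ∃ C : ℝ, 0 < C ∧
      ∀ (d : ℕ) (Ω : Type) (_ : MeasureSpace Ω)
        (_ : IsProbabilityMeasure (volume : Measure Ω))
        (L ε : ℝ), 0 < L → 0 < ε →
      ∀ (F : EuclideanSpace ℝ (Fin d) → EuclideanSpace ℝ (Fin d)),
        (∀ u v, (1 / L) * ‖F u - F v‖ ^ 2 ≤ ⟪F u - F v, u - v⟫) →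
      ∀ (ustar : EuclideanSpace ℝ (Fin d)), F ustar = 0 →
      ∀ (u0 : EuclideanSpace ℝ (Fin d)) (u Ft : ℕ → Ω → EuclideanSpace ℝ (Fin d)),
        (∀ ω, u 0 ω = u0) →
        (∀ j : ℕ, 1 ≤ j → ∀ ω,
          u j ω = ((1 : ℝ) / ((j : ℝ) + 1)) • u0
            + (((j : ℝ)) / ((j : ℝ) + 1)) • (u (j - 1) ω - (1 / L) • Ft (j - 1) ω)) →
        (∀ j, Integrable (fun ω => Ft j ω)) →
        (∀ j, Integrable (fun ω => ‖F (u j ω) - Ft j ω‖ ^ 2)) →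
        (∀ j, Integrable (fun ω => ‖F (u j ω)‖)) →
        (∀ j, Integrable (fun ω => ‖u j ω - u (j - 1) ω‖ ^ 2)) →
      ∀ (k : ℕ), 2 ≤ k →
        (∀ i : ℕ, 1 ≤ i → i ≤ k - 1 →
          (∫ ω, ‖F (u i ω)‖)
            ≤ 76 * L * ‖u0 - ustar‖ / i + (4 * Real.sqrt (2 / 3)) * ε) →
        (∀ i : ℕ, 1 ≤ i → i ≤ k - 1 →
          (∫ ω, ‖F (u i ω) - Ft i ω‖ ^ 2) ≤ ε ^ 2 / i) →
        (∫ ω, ‖F (u 0 ω) - Ft 0 ω‖ ^ 2) ≤ ε ^ 2 / 8 →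
        ε ≤ 76 * L * ‖u0 - ustar‖ / k →
        (∫ ω, ‖u k ω - u (k - 1) ω‖ ^ 2) ≤ C * ‖u0 - ustar‖ ^ 2 / (k : ℝ) ^ 2 := by
  refine ⟨10000000, by norm_num, ?_⟩
  intro d Ω _ _ L ε hL hε F hF us hus u0 u Ft hu0 hrec hFt hE _ hdiff k hk _ hii hi0 hiii
  have hLip : ∀ a b, ‖F a - F b‖ ≤ L * ‖a - b‖ := by
    intro a b
    have h1 := (hF a b).trans (real_inner_le_norm _ _)
    rcases (norm_nonneg (F a - F b)).eq_or_lt with h | h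
    · rw [← h]; positivity
    · rw [one_div, inv_mul_le_iff₀ hL] at h1
      refine le_of_mul_le_mul_left (a := ‖F a - F b‖) ?_ h
      linarith
  have hcont : Continuous F := by
    have : LipschitzWith ⟨L, hL.le⟩ F := LipschitzWith.of_dist_le_mul fun a b => by
      rw [dist_eq_norm, dist_eq_norm]; exact hLip a b
    exact this.continuous
  have hum : ∀ j, AEStronglyMeasurable (u j) volume := by
    intro j
    induction j with
    | zero => rw [show u 0 = fun _ => u0 from funext hu0]; exact aestronglyMeasurable_const
    | succ n ih =>
      rw [show u (n + 1) = _ from funext (hrec (n + 1) (by omega))]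
      have h1 : AEStronglyMeasurable (fun ω => (1 / L) • Ft n ω) volume :=
        (hFt n).aestronglyMeasurable.const_smul (1 / L)
      have h2 : AEStronglyMeasurable (fun ω => u n ω - (1 / L) • Ft n ω) volume := ih.sub h1
      exact aestronglyMeasurable_const.add (h2.const_smul (((n + 1 : ℕ) : ℝ) / (((n + 1 : ℕ) : ℝ) + 1)))
  have hu : ∀ j, MemLp (u j) 2 volume := by
    intro j
    induction j with
    | zero => rw [show u 0 = fun _ => u0 from funext hu0]; exact memLp_const _
    | succ n ih =>
      have h1 : MemLp (fun ω => u (n + 1) ω - u n ω) 2 volume :=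
        (memLp_two_iff_integrable_sq_norm ((hum _).sub (hum _))).2 (hdiff (n + 1))
      have h2 := h1.add ih
      refine h2.congr_norm (hum _) (Filter.Eventually.of_forall fun ω => ?_)
      simp
  have hFum : ∀ j, AEStronglyMeasurable (fun ω => F (u j ω)) volume := fun j =>
    hcont.comp_aestronglyMeasurable (hum j)
  have hFu : ∀ j, MemLp (fun ω => F (u j ω)) 2 volume := by
    intro j
    refine MemLp.of_le_mul (c := L) ((hu j).sub (memLp_const us)) (hFum j)
      (Filter.Eventually.of_forall fun ω => ?_)
    have := hLip (u j ω) us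
    rwa [hus, sub_zero] at this
  have he : ∀ j, MemLp (fun ω => F (u j ω) - Ft j ω) 2 volume := fun j =>
    (memLp_two_iff_integrable_sq_norm ((hFum j).sub (hFt j).aestronglyMeasurable)).2 (hE j)
  have hco : ∀ a b, ‖(1 / L) • F a - (1 / L) • F b‖ ^ 2
      ≤ ⟪(1 / L) • F a - (1 / L) • F b, a - b⟫ := by
    intro a b
    rw [← smul_sub, norm_smul, inner_smul_left, mul_pow, Real.norm_eq_abs, sq_abs, conj_trivial]
    have := mul_le_mul_of_nonneg_left (hF a b) (show 0 ≤ 1 / L by positivity)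
    linarith
  refine aux_main volume u0 us u (fun j ω => (1 / L) • F (u j ω))
    (fun j ω => (1 / L) • (F (u j ω) - Ft j ω)) k hk hu (fun j => (hFu j).const_smul (1 / L))
    (fun j => (he j).const_smul (1 / L)) hu0 ?_ (fun n ω => hco _ _) ?_ ?_
  · intro n ω
    have h := hrec (n + 1) (by omega) ω
    rw [Nat.add_sub_cancel] at h
    push_cast at h
    rw [h]
    have hn : (n : ℝ) + 1 + 1 ≠ 0 := by positivity
    match_scalars <;> field_simp <;> ring
  · intro n ω
    have := hco (u n ω) us
    rwa [hus, smul_zero, sub_zero] at this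
  · intro n hn
    have hkp : (0 : ℝ) < k := by
      have : 0 < k := by omega
      exact_mod_cast this
    have h1 : ((n : ℝ) + 1) * ∫ ω, ‖F (u n ω) - Ft n ω‖ ^ 2 ≤ 2 * ε ^ 2 := by
      rcases Nat.eq_zero_or_pos n with rfl | hpos
      · simp only [Nat.cast_zero]
        nlinarith [sq_nonneg ε]
      · have h := hii n hpos (by omega)
        have hn1 : (1 : ℝ) ≤ n := by exact_mod_cast hpos
        have h' := mul_le_mul_of_nonneg_left h (show (0 : ℝ) ≤ (n : ℝ) + 1 by positivity)
        refine h'.trans ?_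
        rw [← mul_div_assoc, div_le_iff₀ (by positivity)]
        nlinarith [sq_nonneg ε]
    have h2 : (ε * k) ^ 2 ≤ (76 * L * ‖u0 - us‖) ^ 2 :=
      pow_le_pow_left₀ (by positivity) ((le_div_iff₀ hkp).1 hiii) 2
    simp only [norm_smul, mul_pow, integral_const_mul, Real.norm_eq_abs, sq_abs]
    have h3 := mul_le_mul_of_nonneg_left h1 (show 0 ≤ (k : ℝ) ^ 2 by positivity)
    have h4 : ((n : ℝ) + 1) * (k : ℝ) ^ 2 * ((1 / L) ^ 2 * ∫ ω, ‖F (u n ω) - Ft n ω‖ ^ 2)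
      = ((k : ℝ) ^ 2 * (((n : ℝ) + 1) * ∫ ω, ‖F (u n ω) - Ft n ω‖ ^ 2)) / L ^ 2 := by
      field_simp
    rw [h4, div_le_iff₀ (by positivity)]
    nlinarith
end

section
/- Let U ⊆ ℝ^d be nonempty, closed, and convex, F : ℝ^d → ℝ^d be (1/L)-cocoercive, and u* ∈ U satisfy ⟨F(u*), u − u*⟩ ≥ 0 for all u ∈ U. Define G(u) = L(u − Π_U(u − F(u)/L)) and G̃(u) = L(u − Π_U(u − F̃(u)/L)). On a probability space, let u_0 ∈ ℝ^d be deterministic and let random iterates evolve by u_{k+1} = λ_{k+1} u_0 + (1 − λ_{k+1})(u_k − G̃(u_k)/L) with λ_k = 1/(k+1), where F̃(u_k) are random estimates satisfying E[‖F(u_0) − F̃(u_0)‖²] ≤ ε²/8 and E[‖F(u_k) − F̃(u_k)‖²] ≤ ε²/k for all k ≥ 1, for a given ε > 0. Then for all k ≥ 1, E[‖G(u_k)‖] ≤ Λ₀/k + Λ₁ ε, with Λ₀ = 20 L ‖u_0 − u*‖ and Λ₁ = √13; consequently E[‖G(u_N)‖] ≤ 5ε for N = ⌈2Λ₀/ε⌉.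 -/
open MeasureTheory
open scoped RealInnerProductSpace

section Helpers

variable {E : Type*} [NormedAddCommGroup E] [InnerProductSpace ℝ E]

theorem aux_proj_firm (U : Set E) (hUconv : Convex ℝ U) (proj : E → E)
    (hproj : ∀ x, proj x ∈ U ∧ ∀ y ∈ U, ‖x - proj x‖ ≤ ‖x - y‖) (a b : E) :
    ‖proj a - proj b‖ ^ 2 ≤ ⟪proj a - proj b, a - b⟫ := by
  have key : ∀ x, ∀ w ∈ U, ⟪x - proj x, w - proj x⟫ ≤ 0 := by
    intro x
    refine (norm_eq_iInf_iff_real_inner_le_zero hUconv (hproj x).1).1 ?_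
    have : Nonempty U := ⟨⟨proj x, (hproj x).1⟩⟩
    refine le_antisymm (le_ciInf fun y => (hproj x).2 y y.2) ?_
    exact ciInf_le ⟨0, by rintro _ ⟨y, rfl⟩; exact norm_nonneg _⟩
      (⟨proj x, (hproj x).1⟩ : U)
  have h1 := key a (proj b) (hproj b).1
  have h2 := key b (proj a) (hproj a).1
  rw [← real_inner_self_eq_norm_sq]
  simp only [inner_sub_left, inner_sub_right] at *
  have c1 := real_inner_comm (proj a) (proj b)
  have c2 := real_inner_comm (proj a) a
  have c3 := real_inner_comm (proj b) a
  have c4 := real_inner_comm (proj a) b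
  have c5 := real_inner_comm (proj b) b
  linarith

theorem aux_proj_lip (U : Set E) (hUconv : Convex ℝ U) (proj : E → E)
    (hproj : ∀ x, proj x ∈ U ∧ ∀ y ∈ U, ‖x - proj x‖ ≤ ‖x - y‖) (a b : E) :
    ‖proj a - proj b‖ ≤ ‖a - b‖ := by
  have h := aux_proj_firm U hUconv proj hproj a b
  have h2 := real_inner_le_norm (proj a - proj b) (a - b)
  by_contra hc
  push Not at hc
  nlinarith [norm_nonneg (a - b), norm_nonneg (proj a - proj b)]

/-- `3/4`-cocoercivity; `D = x - y`, `f` the scaled operator difference, `p` projected difference. -/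
theorem aux_coco (D f p : E) (h1 : ‖f‖ ^ 2 ≤ ⟪f, D⟫) (h2 : ‖p‖ ^ 2 ≤ ⟪p, D - f⟫) :
    3 / 4 * ‖D - p‖ ^ 2 ≤ ⟪D - p, D⟫ := by
  have h3 : 0 ≤ ‖f - (D - f - p)‖ ^ 2 := by positivity
  rw [← real_inner_self_eq_norm_sq] at *
  simp only [inner_sub_left, inner_sub_right] at *
  have c1 := real_inner_comm f D
  have c2 := real_inner_comm p D
  have c3 := real_inner_comm p f
  linarith

theorem aux_step_s15 (K : ℝ) (hK : 0 ≤ K) (u0 u u' R R' e : E)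
    (hu : (K + 2) • u' = u0 + (K + 1) • (u - R + e))
    (hc : 3 / 4 * ‖R' - R‖ ^ 2 ≤ ⟪R' - R, u' - u⟫) :
    (K + 1) * (K + 2) * ‖R'‖ ^ 2 + 2 * (K + 2) * ⟪R', u' - u0⟫ ≤
      K * (K + 1) * ‖R‖ ^ 2 + 2 * (K + 1) * ⟪R, u - u0⟫
        + 2 * (K + 1) * (K + 2) * ‖e‖ ^ 2 + 2 * (K + 1) * ⟪R, e⟫ := by
  have e0 : u0 = (K + 2) • u' - (K + 1) • (u - R + e) := by rw [hu]; abel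
  obtain ⟨d, rfl⟩ : ∃ d, u' = u + d := ⟨u' - u, by abel⟩
  have e1 : u + d - u0 = (K + 1) • (e - R - d) := by rw [e0]; module
  have e2 : u - u0 = (K + 1) • (e - R) - (K + 2) • d := by rw [e0]; module
  rw [e1, e2]
  have h3 : 0 ≤ ‖(R' - R) - (2 : ℝ) • e‖ ^ 2 := by positivity
  rw [add_sub_cancel_left] at hc
  have hm : ‖R' - R‖ ^ 2 + 2 * ⟪R' - R, e⟫ - 2 * ‖e‖ ^ 2 - 2 * ⟪R' - R, d⟫ ≤ 0 := by
    rw [@norm_sub_sq_real _ _ _ (R' - R), norm_smul, mul_pow, inner_smul_right] at h3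
    norm_num at h3
    linarith
  have hm2 := mul_nonneg (mul_nonneg (by linarith : 0 ≤ K + 1) (by linarith : 0 ≤ K + 2))
    (neg_nonneg.2 hm)
  rw [@norm_sub_sq_real _ _ _ R' R] at hm2
  simp only [inner_sub_left, inner_sub_right, inner_smul_right, real_inner_self_eq_norm_sq] at *
  linarith

end Helpers

noncomputable def auxA (k : ℕ) : ℝ := if k = 0 then 1 else ((k : ℝ) + 1) / (4 * k)

noncomputable def auxB (k : ℕ) : ℝ :=
  if k = 0 then 5 else 2 * ((k : ℝ) + 1) * (k + 2) + 4 * k * (k + 1)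

theorem aux_young (k : ℕ) (r d t : ℝ) (ht : t ≤ r * d) :
    2 * ((k : ℝ) + 1) * (k + 2) * d ^ 2 + 2 * ((k : ℝ) + 1) * t ≤
      auxA k * r ^ 2 + auxB k * d ^ 2 := by
  unfold auxA auxB
  rcases Nat.eq_zero_or_pos k with rfl | hk
  · simp
    nlinarith [sq_nonneg (r - d)]
  · have hk' : (0 : ℝ) < k := by exact_mod_cast hk
    simp only [hk.ne', if_false]
    have : 2 * (r * d) ≤ r ^ 2 / (4 * k) + 4 * k * d ^ 2 := by
      have : r ^ 2 / (4 * k) + 4 * k * d ^ 2 - 2 * (r * d) = (r - 4 * k * d) ^ 2 / (4 * k) := by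
        field_simp
        ring
      have : 0 ≤ (r - 4 * k * d) ^ 2 / (4 * k) := by positivity
      linarith
    have h2 := mul_le_mul_of_nonneg_left (this.trans' (mul_le_mul_of_nonneg_left ht (by norm_num : (0:ℝ) ≤ 2)))
      (by linarith : (0:ℝ) ≤ (k:ℝ) + 1)
    have h3 : ((k : ℝ) + 1) / (4 * k) * r ^ 2 = ((k : ℝ) + 1) * (r ^ 2 / (4 * k)) := by ring
    rw [h3]
    linarith

theorem aux_int_s15 {Ω : Type*} [MeasureSpace Ω] [IsProbabilityMeasure (volume : Measure Ω)]
    (r δ : ℕ → Ω → ℝ) (D η : ℝ) (hD : 0 ≤ D) (hη : 0 < η)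
    (hri : ∀ k, Integrable (r k))
    (hδi : ∀ k, Integrable (fun ω => δ k ω ^ 2))
    (h0 : (∫ ω, δ 0 ω ^ 2) ≤ η ^ 2 / 8)
    (h1 : ∀ k : ℕ, 1 ≤ k → (∫ ω, δ k ω ^ 2) ≤ η ^ 2 / k)
    (hpt : ∀ k : ℕ, ∀ ω, ((k : ℝ) + 1) * (k + 3 / 2) / 2 * r k ω ^ 2 ≤
      2 * D ^ 2 + ∑ j ∈ Finset.range k, (auxA j * r j ω ^ 2 + auxB j * δ j ω ^ 2)) :
    ∀ k : ℕ, 1 ≤ k → (∫ ω, r k ω) ≤ 20 * D / k + Real.sqrt 13 * η := by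
  have hr2 : ∀ k, Integrable (fun ω => r k ω ^ 2) := by
    intro k
    induction k using Nat.strong_induction_on with
    | _ k ih =>
      have hI : Integrable (fun ω => 2 * D ^ 2 +
          ∑ j ∈ Finset.range k, (auxA j * r j ω ^ 2 + auxB j * δ j ω ^ 2)) := by
        refine (integrable_const _).add (integrable_finsetSum _ fun j hj => ?_)
        exact ((ih j (Finset.mem_range.1 hj)).const_mul _).add ((hδi j).const_mul _)
      have hc : (0 : ℝ) < ((k : ℝ) + 1) * (k + 3 / 2) / 2 := by positivity
      refine (hI.const_mul (((k : ℝ) + 1) * (k + 3 / 2) / 2)⁻¹).mono'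
        ((hri k).aestronglyMeasurable.pow 2) (Filter.Eventually.of_forall fun ω => ?_)
      rw [Real.norm_of_nonneg (by positivity), inv_mul_eq_div, le_div_iff₀ hc]
      linarith [hpt k ω]
  set y : ℕ → ℝ := fun k => ∫ ω, r k ω ^ 2 with hy
  set v : ℕ → ℝ := fun k => ∫ ω, δ k ω ^ 2 with hv
  have hterm : ∀ j, Integrable (fun ω => auxA j * r j ω ^ 2 + auxB j * δ j ω ^ 2) :=
    fun j => ((hr2 j).const_mul _).add ((hδi j).const_mul _)
  set X : ℕ → ℝ := fun k => 2 * D ^ 2 + ∑ j ∈ Finset.range k, (auxA j * y j + auxB j * v j) with hX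
  have hyX : ∀ k : ℕ, ((k : ℝ) + 1) * (k + 3 / 2) / 2 * y k ≤ X k := by
    intro k
    have h := integral_mono ((hr2 k).const_mul (((k : ℝ) + 1) * (k + 3 / 2) / 2))
      ((integrable_const (2 * D ^ 2)).add (integrable_finsetSum (Finset.range k) fun j _ => hterm j))
      (fun ω => hpt k ω)
    rw [integral_const_mul, integral_add' (integrable_const _)
      (integrable_finsetSum _ fun j _ => hterm j), integral_finsetSum _ fun j _ => hterm j] at h
    simp only [integral_const, probReal_univ, one_smul] at h
    refine h.trans_eq ?_
    simp only [hX]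
    congr 1
    refine Finset.sum_congr rfl fun j _ => ?_
    rw [integral_add ((hr2 j).const_mul _) ((hδi j).const_mul _), integral_const_mul,
      integral_const_mul]
  have hXb : ∀ k : ℕ, X (k + 1) ≤ 6 * D ^ 2 * (2 - 1 / ((k : ℝ) + 1))
      + 6 * η ^ 2 * ((k : ℝ) + 1) * (k + 2) := by
    intro k
    induction k with
    | zero =>
      have := hyX 0
      simp [hX, auxA, auxB] at this ⊢
      have h0' : v 0 ≤ η ^ 2 / 8 := h0
      nlinarith [sq_nonneg D, sq_nonneg η]
    | succ k ih =>
      have hs : X (k + 1 + 1) = X (k + 1) + (auxA (k + 1) * y (k + 1) + auxB (k + 1) * v (k + 1)) := by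
        simp only [hX]
        rw [Finset.sum_range_succ]
        ring
      have a1 := hyX (k + 1)
      have a2 : v (k + 1) ≤ η ^ 2 / ((k + 1 : ℕ) : ℝ) := h1 (k + 1) (by omega)
      rw [hs]
      simp only [auxA, auxB, Nat.succ_ne_zero, if_false] at *
      push_cast at *
      set q : ℝ := (k : ℝ) + 1 with hq
      have hq1 : 1 ≤ q := by rw [hq]; linarith [(Nat.cast_nonneg k : (0:ℝ) ≤ k)]
      have hq0 : 0 < q := by linarith
      have e2 : (k : ℝ) + 2 = q + 1 := by rw [hq]; ring
      rw [e2] at ih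
      -- bounds
      have b1 : (q + 1) / (4 * q) * y (k + 1) ≤ X (k + 1) / (2 * q * (q + 1)) := by
        have hb : y (k + 1) ≤ X (k + 1) / ((q + 1) * (q + 3 / 2) / 2) := by
          rw [le_div_iff₀ (by positivity)]; linarith
        have hX0 : 0 ≤ X (k + 1) := by
          refine le_trans ?_ a1
          have : 0 ≤ y (k + 1) := integral_nonneg fun ω => sq_nonneg _
          positivity
        calc (q + 1) / (4 * q) * y (k + 1)
            ≤ (q + 1) / (4 * q) * (X (k + 1) / ((q + 1) * (q + 3 / 2) / 2)) :=
              mul_le_mul_of_nonneg_left hb (by positivity)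
          _ = X (k + 1) / (2 * q * (q + 3 / 2)) := by field_simp; ring
          _ ≤ X (k + 1) / (2 * q * (q + 1)) := by
              apply div_le_div_of_nonneg_left hX0 (by positivity)
              nlinarith
      have b2 : (2 * (q + 1) * (q + 2) + 4 * q * (q + 1)) * v (k + 1) ≤
          (2 * (q + 1) * (q + 2) + 4 * q * (q + 1)) * (η ^ 2 / q) :=
        mul_le_mul_of_nonneg_left a2 (by positivity)
      have b3 : X (k + 1) / (2 * q * (q + 1)) ≤ 6 * D ^ 2 * (1 / q - 1 / (q + 1)) + 3 * η ^ 2 := by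
        rw [div_le_iff₀ (by positivity)]
        have : (6 * D ^ 2 * (1 / q - 1 / (q + 1)) + 3 * η ^ 2) * (2 * q * (q + 1))
            = 12 * D ^ 2 + 6 * η ^ 2 * q * (q + 1) := by field_simp; ring
        rw [this]
        have h5 : 0 ≤ 6 * D ^ 2 * (1 / q) := by positivity
        linarith
      have b4 : (2 * (q + 1) * (q + 2) + 4 * q * (q + 1)) * (η ^ 2 / q) ≤ 10 * (q + 1) * η ^ 2 := by
        rw [mul_div_assoc', div_le_iff₀ hq0]
        have : 0 ≤ η ^ 2 * (q + 1) * (q - 1) :=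
          mul_nonneg (by positivity) (by linarith)
        nlinarith
      have b5 : 0 ≤ η ^ 2 * (q - 1) := mul_nonneg (by positivity) (by linarith)
      have b6 : 0 ≤ η ^ 2 := by positivity
      nlinarith
  intro k hk
  obtain ⟨m, rfl⟩ : ∃ m, k = m + 1 := ⟨k - 1, by omega⟩
  have c1 := hyX (m + 1)
  have c2 := hXb m
  push_cast at c1 ⊢
  set q : ℝ := (m : ℝ) + 1 with hq
  have hq1 : 1 ≤ q := by rw [hq]; linarith [(Nat.cast_nonneg m : (0:ℝ) ≤ m)]
  have hq0 : 0 < q := by linarith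
  have e2 : (m : ℝ) + 2 = q + 1 := by rw [hq]; ring
  rw [e2] at c2
  have hy0 : 0 ≤ y (m + 1) := integral_nonneg fun ω => sq_nonneg _
  have c3 : y (m + 1) ≤ 24 * (D / q) ^ 2 + 12 * η ^ 2 := by
    have h5 : 0 ≤ 6 * D ^ 2 * (1 / q) := by positivity
    have h6 : q * (q + 1) * y (m + 1) ≤ 24 * D ^ 2 + 12 * η ^ 2 * q * (q + 1) := by
      nlinarith [mul_nonneg hy0 hq0.le]
    have h7 : 24 * (D / q) ^ 2 + 12 * η ^ 2 = (24 * D ^ 2 + 12 * η ^ 2 * q * q) / (q * q) := by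
      field_simp
    have h9 : q * (q + 1) * (y (m + 1) - 12 * η ^ 2) ≤ 24 * D ^ 2 := by linarith
    rw [h7, le_div_iff₀ (by positivity)]
    rcases le_total (y (m + 1)) (12 * η ^ 2) with h | h
    · nlinarith [mul_nonneg (sub_nonneg.2 h) (mul_pos hq0 hq0).le, sq_nonneg D]
    · nlinarith [mul_nonneg (sub_nonneg.2 h) hq0.le]
  set s := Real.sqrt 13 with hs
  have hs2 : s ^ 2 = 13 := Real.sq_sqrt (by norm_num)
  have hs0 : 0 < s := Real.sqrt_pos.2 (by norm_num)
  set t := 20 * D / q + s * η with ht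
  have ht0 : 0 < t := by positivity
  have c4 : y (m + 1) ≤ t ^ 2 := by
    have h1 : t ^ 2 = 400 * (D / q) ^ 2 + 40 * (D / q) * (s * η) + s ^ 2 * η ^ 2 := by
      rw [ht]; ring
    have h2 : 0 ≤ 40 * (D / q) * (s * η) := by positivity
    rw [h1, hs2]
    nlinarith [sq_nonneg (D / q), sq_nonneg η]
  have c5 : ∫ ω, 2 * t * r (m + 1) ω ≤ ∫ ω, (r (m + 1) ω ^ 2 + t ^ 2) :=
    integral_mono ((hri _).const_mul _) ((hr2 _).add (integrable_const _))
      (fun ω => by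
        show 2 * t * r (m + 1) ω ≤ r (m + 1) ω ^ 2 + t ^ 2
        nlinarith [sq_nonneg (r (m + 1) ω - t)])
  rw [integral_const_mul, integral_add (hr2 _) (integrable_const _)] at c5
  simp only [integral_const, probReal_univ, one_smul] at c5
  have c6 : 2 * t * (∫ ω, r (m + 1) ω) ≤ y (m + 1) + t ^ 2 := c5
  by_contra hcon
  push Not at hcon
  nlinarith

/-- Convergence of the constrained stochastic Halpern iteration
`u_{k+1} = λ_{k+1} u_0 + (1 − λ_{k+1})(u_k − G̃(u_k)/L)` (with `λ_k = 1/(k+1)`) for a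
`(1/L)`-cocoercive operator `F` with an SVI solution `u* ∈ U`, in terms of the operator
mappings `G(u) = L(u − Π_U(u − F(u)/L))` and `G̃(u) = L(u − Π_U(u − F̃(u)/L))`. -/
theorem constrained_stochastic_halpern_convergence
    {d : ℕ} {Ω : Type*} [MeasureSpace Ω] [IsProbabilityMeasure (volume : Measure Ω)]
    (U : Set (EuclideanSpace ℝ (Fin d)))
    (hUne : U.Nonempty) (hUclosed : IsClosed U) (hUconv : Convex ℝ U)
    (proj : EuclideanSpace ℝ (Fin d) → EuclideanSpace ℝ (Fin d))
    (hproj : ∀ x, proj x ∈ U ∧ ∀ y ∈ U, ‖x - proj x‖ ≤ ‖x - y‖)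
    (L ε : ℝ) (hL : 0 < L) (hε : 0 < ε)
    (F : EuclideanSpace ℝ (Fin d) → EuclideanSpace ℝ (Fin d))
    (hcoco : ∀ u v, (1 / L) * ‖F u - F v‖ ^ 2 ≤ ⟪F u - F v, u - v⟫)
    (ustar : EuclideanSpace ℝ (Fin d)) (hustar : ustar ∈ U)
    (hsvi : ∀ w ∈ U, 0 ≤ ⟪F ustar, w - ustar⟫)
    (G : EuclideanSpace ℝ (Fin d) → EuclideanSpace ℝ (Fin d))
    (hG : ∀ x, G x = L • (x - proj (x - (1 / L) • F x)))
    (u0 : EuclideanSpace ℝ (Fin d))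
    (u Ftu Gt : ℕ → Ω → EuclideanSpace ℝ (Fin d))
    (hGt : ∀ k ω, Gt k ω = L • (u k ω - proj (u k ω - (1 / L) • Ftu k ω)))
    (hu0 : ∀ ω, u 0 ω = u0)
    (hrec : ∀ k : ℕ, ∀ ω,
      u (k + 1) ω = ((1 : ℝ) / ((k : ℝ) + 2)) • u0
        + (1 - (1 : ℝ) / ((k : ℝ) + 2)) • (u k ω - (1 / L) • Gt k ω))
    (hintG : ∀ k, Integrable (fun ω => ‖G (u k ω)‖))
    (hintVar : ∀ k, Integrable (fun ω => ‖F (u k ω) - Ftu k ω‖ ^ 2))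
    (hvar0 : (∫ ω, ‖F (u 0 ω) - Ftu 0 ω‖ ^ 2) ≤ ε ^ 2 / 8)
    (hvar : ∀ k : ℕ, 1 ≤ k → (∫ ω, ‖F (u k ω) - Ftu k ω‖ ^ 2) ≤ ε ^ 2 / k) :
    (∀ k : ℕ, 1 ≤ k →
      (∫ ω, ‖G (u k ω)‖) ≤ 20 * L * ‖u0 - ustar‖ / k + Real.sqrt 13 * ε)
    ∧ (∫ ω, ‖G (u (⌈2 * (20 * L * ‖u0 - ustar‖) / ε⌉₊) ω)‖) ≤ 5 * ε := by
  have hLne : L ≠ 0 := hL.ne'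
  set R : EuclideanSpace ℝ (Fin d) → EuclideanSpace ℝ (Fin d) :=
    fun x => x - proj (x - (1 / L) • F x) with hR
  have hGR : ∀ x, ‖G x‖ = L * ‖R x‖ := by
    intro x
    rw [hG, norm_smul, Real.norm_of_nonneg hL.le]
  have hRc : ∀ x y, 3 / 4 * ‖R x - R y‖ ^ 2 ≤ ⟪R x - R y, x - y⟫ := by
    intro x y
    have h1 : ‖(1 / L) • (F x - F y)‖ ^ 2 ≤ ⟪(1 / L) • (F x - F y), x - y⟫ := by
      rw [norm_smul, inner_smul_left, mul_pow, Real.norm_of_nonneg (by positivity)]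
      have := mul_le_mul_of_nonneg_left (hcoco x y) (by positivity : 0 ≤ 1 / L)
      simp only [conj_trivial]
      linarith
    have h2 := aux_proj_firm U hUconv proj hproj (x - (1 / L) • F x) (y - (1 / L) • F y)
    have e1 : x - (1 / L) • F x - (y - (1 / L) • F y) = x - y - (1 / L) • (F x - F y) := by
      rw [smul_sub]; abel
    rw [e1] at h2
    have h3 := aux_coco _ _ _ h1 h2
    have e2 : R x - R y = x - y -
        (proj (x - (1 / L) • F x) - proj (y - (1 / L) • F y)) := by
      simp only [hR]; abel
    rw [e2]
    exact h3
  have hRs : R ustar = 0 := by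
    have h1 := aux_proj_firm U hUconv proj hproj (ustar - (1 / L) • F ustar) ustar
    have h2 : proj ustar = ustar := by
      have := (hproj ustar).2 ustar hustar
      rw [sub_self, norm_zero] at this
      exact (sub_eq_zero.1 (norm_le_zero_iff.1 this)).symm
    rw [h2] at h1
    have h3 := hsvi _ (hproj (ustar - (1 / L) • F ustar)).1
    have e1 : ustar - (1 / L) • F ustar - ustar = -((1 / L) • F ustar) := by abel
    rw [e1, inner_neg_right, inner_smul_right, real_inner_comm] at h1
    have h4 : 0 ≤ 1 / L * ⟪F ustar, proj (ustar - (1 / L) • F ustar) - ustar⟫ := by positivity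
    have h5 : ‖proj (ustar - (1 / L) • F ustar) - ustar‖ ^ 2 ≤ 0 := by linarith
    have h6 : proj (ustar - (1 / L) • F ustar) - ustar = 0 := by
      rw [← norm_eq_zero]
      exact pow_eq_zero_iff (two_ne_zero) |>.1 (le_antisymm h5 (by positivity))
    show ustar - proj (ustar - (1 / L) • F ustar) = 0
    rw [← neg_sub, h6, neg_zero]
  set D := ‖u0 - ustar‖ with hD
  have hD0 : 0 ≤ D := norm_nonneg _
  set r : ℕ → Ω → ℝ := fun k ω => ‖R (u k ω)‖ with hr
  set δ : ℕ → Ω → ℝ := fun k ω => (1 / L) * ‖F (u k ω) - Ftu k ω‖ with hδ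
  have hpot : ∀ k : ℕ, ∀ ω, (k : ℝ) * (k + 1) * ‖R (u k ω)‖ ^ 2
      + 2 * ((k : ℝ) + 1) * ⟪R (u k ω), u k ω - u0⟫ ≤
      ∑ j ∈ Finset.range k, (auxA j * r j ω ^ 2 + auxB j * δ j ω ^ 2) := by
    intro k ω
    induction k with
    | zero => simp [hu0]
    | succ k ih =>
      set e := proj (u k ω - (1 / L) • Ftu k ω) - proj (u k ω - (1 / L) • F (u k ω)) with he
      have hed : ‖e‖ ≤ δ k ω := by
        refine (aux_proj_lip U hUconv proj hproj _ _).trans_eq ?_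
        have : u k ω - (1 / L) • Ftu k ω - (u k ω - (1 / L) • F (u k ω))
            = (1 / L) • (F (u k ω) - Ftu k ω) := by rw [smul_sub]; abel
        rw [this, norm_smul, Real.norm_of_nonneg (by positivity)]
      have hk2 : (k : ℝ) + 2 ≠ 0 := by positivity
      have hstep : ((k : ℝ) + 2) • u (k + 1) ω = u0 + ((k : ℝ) + 1) • (u k ω - R (u k ω) + e) := by
        have e1 : u k ω - (1 / L) • Gt k ω = u k ω - R (u k ω) + e := by
          rw [hGt, smul_smul, one_div_mul_cancel hLne, one_smul, he]
          simp only [hR]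
          abel
        rw [hrec, e1, smul_add, smul_smul, smul_smul]
        have e3 : ((k : ℝ) + 2) * (1 / ((k : ℝ) + 2)) = 1 := by field_simp
        have e4 : ((k : ℝ) + 2) * (1 - 1 / ((k : ℝ) + 2)) = (k : ℝ) + 1 := by
          rw [mul_sub, e3]; ring
        rw [e3, e4, one_smul]
      have h1 := aux_step_s15 (k : ℝ) (Nat.cast_nonneg k) u0 _ _ _ _ e hstep (hRc _ _)
      have h2 : ⟪R (u k ω), e⟫ ≤ r k ω * δ k ω :=
        (real_inner_le_norm _ _).trans (mul_le_mul_of_nonneg_left hed (norm_nonneg _))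
      have h3 := aux_young k (r k ω) (δ k ω) _ h2
      have h4 : 2 * ((k : ℝ) + 1) * (k + 2) * ‖e‖ ^ 2 ≤ 2 * ((k : ℝ) + 1) * (k + 2) * δ k ω ^ 2 := by
        gcongr
      rw [Finset.sum_range_succ]
      push_cast
      have e5 : (k : ℝ) + 1 + 1 = k + 2 := by ring
      rw [e5]
      linarith
  have hmain := aux_int_s15 r δ D (ε / L) hD0 (by positivity)
    (by
      intro k
      have := (hintG k).const_mul (1 / L)
      refine this.congr (Filter.Eventually.of_forall fun ω => ?_)
      show 1 / L * ‖G (u k ω)‖ = ‖R (u k ω)‖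
      rw [hGR]
      field_simp)
    (by
      intro k
      have := (hintVar k).const_mul ((1 / L) ^ 2)
      refine this.congr (Filter.Eventually.of_forall fun ω => ?_)
      simp only [hδ, mul_pow])
    (by
      simp only [hδ, mul_pow]
      rw [integral_const_mul]
      have := mul_le_mul_of_nonneg_left hvar0 (by positivity : 0 ≤ (1 / L) ^ 2)
      refine this.trans_eq ?_
      ring)
    (by
      intro k hk
      simp only [hδ, mul_pow]
      rw [integral_const_mul]
      have := mul_le_mul_of_nonneg_left (hvar k hk) (by positivity : 0 ≤ (1 / L) ^ 2)
      refine this.trans_eq ?_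
      ring)
    (by
      intro k ω
      have h1 := hpot k ω
      have h2 := hRc (u k ω) ustar
      rw [hRs, sub_zero] at h2
      have h3 : ⟪R (u k ω), u k ω - u0⟫ =
          ⟪R (u k ω), u k ω - ustar⟫ - ⟪R (u k ω), u0 - ustar⟫ := by
        rw [← inner_sub_right]; congr 1; abel
      have h4 : ⟪R (u k ω), u0 - ustar⟫ ≤ r k ω * D := real_inner_le_norm _ _
      change (k : ℝ) * (k + 1) * r k ω ^ 2 + _ ≤ _ at h1
      change 3 / 4 * r k ω ^ 2 ≤ _ at h2
      have hk0 : (0 : ℝ) ≤ k := Nat.cast_nonneg k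
      have h5 : 2 * ((k : ℝ) + 1) * (3 / 4 * r k ω ^ 2 - r k ω * D) ≤
          2 * ((k : ℝ) + 1) * ⟪R (u k ω), u k ω - u0⟫ := by
        apply mul_le_mul_of_nonneg_left _ (by positivity)
        linarith
      have h6 : 0 ≤ ((k : ℝ) + 1) * ((k : ℝ) + 1) / 2 * r k ω ^ 2 - 2 * (k + 1) * (r k ω * D)
          + 2 * D ^ 2 := by
        nlinarith [sq_nonneg (((k : ℝ) + 1) * r k ω - 2 * D)]
      have h7 : 0 ≤ ((k : ℝ) + 1) * r k ω ^ 2 := by positivity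
      linarith)
  have hfin : ∀ k : ℕ, 1 ≤ k →
      (∫ ω, ‖G (u k ω)‖) ≤ 20 * L * D / k + Real.sqrt 13 * ε := by
    intro k hk
    simp only [hGR]
    rw [integral_const_mul]
    have := mul_le_mul_of_nonneg_left (hmain k hk) hL.le
    refine this.trans_eq ?_
    field_simp
  refine ⟨hfin, ?_⟩
  rcases Nat.eq_zero_or_pos ⌈2 * (20 * L * D) / ε⌉₊ with h0 | hpos
  · rw [h0]
    have h1 := Nat.ceil_eq_zero.1 h0
    have hDz : D = 0 := by
      by_contra hne
      have : 0 < D := lt_of_le_of_ne hD0 (Ne.symm hne)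
      have : 0 < 2 * (20 * L * D) / ε := by positivity
      linarith
    have hus : u0 = ustar := sub_eq_zero.1 (norm_eq_zero.1 hDz)
    simp only [hu0, hGR, hus, hRs]
    simp
    positivity
  · refine (hfin _ hpos).trans ?_
    have h1 := Nat.le_ceil (2 * (20 * L * D) / ε)
    set N : ℝ := (⌈2 * (20 * L * D) / ε⌉₊ : ℝ) with hN
    have hN0 : 0 < N := by rw [hN]; exact_mod_cast hpos
    rw [div_le_iff₀ hε] at h1
    have h2 : 20 * L * D / N ≤ ε / 2 := by
      rw [div_le_iff₀ hN0]; linarith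
    have h3 : Real.sqrt 13 ≤ 4 := by
      rw [Real.sqrt_le_left (by norm_num)]; norm_num
    nlinarith
end

section
/- Given M > 0, define λ_k = 1/(k+2) for k ≥ 0 and the sequence (η_k)_{k≥0} by the recursion η_{k+1} = ((1 − λ_k² − Mη_k²) λ_{k+1} η_k)/((1 − Mη_k²)(1 − λ_k) λ_k), with 0 < η_0 < √3/(2√M). Then (η_k) is non-increasing: η_{k+1} ≤ η_k ≤ η_0 for all k. Moreover, if 0 < η_0 < 1/√(2M), then η* := lim_{k→∞} η_k exists and η* ≥ η̲ := η_0(1 − 2Mη_0²)/(1 − Mη_0²) > 0. -/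
open Filter

/-- With `λ_k = 1/(k+2)`, the step-size recursion
`η_{k+1} = ((1 − λ_k² − M η_k²) λ_{k+1} η_k)/((1 − M η_k²)(1 − λ_k) λ_k)` starting from
`0 < η_0 < √3/(2√M)` produces a non-increasing sequence bounded by `η_0`; moreover, if
`η_0 < 1/√(2M)` then the limit `η* = lim η_k` exists and satisfies
`η* ≥ η_0 (1 − 2Mη_0²)/(1 − Mη_0²) > 0`. -/
theorem eta_recursion_monotone_and_limit
    (M : ℝ) (hM : 0 < M) (η : ℕ → ℝ)
    (hη0pos : 0 < η 0) (hη0lt : η 0 < Real.sqrt 3 / (2 * Real.sqrt M))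
    (hrec : ∀ k : ℕ,
      η (k + 1) =
        ((1 - (1 / ((k : ℝ) + 2)) ^ 2 - M * η k ^ 2) * (1 / ((k : ℝ) + 3)) * η k) /
          ((1 - M * η k ^ 2) * (1 - 1 / ((k : ℝ) + 2)) * (1 / ((k : ℝ) + 2)))) :
    (∀ k : ℕ, η (k + 1) ≤ η k) ∧ (∀ k : ℕ, η k ≤ η 0) ∧
      (η 0 < 1 / Real.sqrt (2 * M) →
        ∃ ηstar : ℝ, Tendsto η atTop (nhds ηstar) ∧
          η 0 * (1 - 2 * M * η 0 ^ 2) / (1 - M * η 0 ^ 2) ≤ ηstar ∧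
          0 < η 0 * (1 - 2 * M * η 0 ^ 2) / (1 - M * η 0 ^ 2)) := by
  have hsq : M * η 0 ^ 2 < 3 / 4 := by
    have h1 : 0 < Real.sqrt M := Real.sqrt_pos.mpr hM
    rw [lt_div_iff₀ (by positivity)] at hη0lt
    have h2 : (η 0 * (2 * Real.sqrt M)) ^ 2 < Real.sqrt 3 ^ 2 :=
      pow_lt_pow_left₀ hη0lt (by positivity) (by norm_num)
    rw [Real.sq_sqrt (by norm_num), mul_pow, mul_pow, Real.sq_sqrt hM.le] at h2
    linarith
  have hx0 : 0 < 1 - M * η 0 ^ 2 := by linarith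
  have key : ∀ k : ℕ, 0 < 1 - M * η k ^ 2 → η (k + 1) =
      η k - η k * (M * η k ^ 2 / (1 - M * η k ^ 2)) / (((k : ℝ) + 1) * ((k : ℝ) + 3)) := by
    intro k hk
    rw [hrec k]
    have h1 : (k : ℝ) + 1 ≠ 0 := by positivity
    have h2 : (k : ℝ) + 2 ≠ 0 := by positivity
    have h3 : (k : ℝ) + 3 ≠ 0 := by positivity
    have e : 1 - 1 / ((k : ℝ) + 2) = ((k : ℝ) + 1) / ((k : ℝ) + 2) := by
      field_simp
      ring
    rw [e]
    have h4 := hk.ne'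
    generalize hx : M * η k ^ 2 = x at *
    field_simp
    ring
  have mono : ∀ a : ℝ, 0 < a → a ≤ η 0 → M * a ^ 2 ≤ M * η 0 ^ 2 := by
    intro a h1 h2
    gcongr
  have inv : ∀ k : ℕ, 0 < η k ∧ η k ≤ η 0 ∧ η (k + 1) ≤ η k ∧ 0 < η (k + 1) := by
    have step : ∀ k : ℕ, 0 < η k → η k ≤ η 0 → η (k + 1) ≤ η k ∧ 0 < η (k + 1) := by
      intro k h1 h2
      have h3 := mono _ h1 h2
      have h4 : 0 < 1 - M * η k ^ 2 := by linarith
      have hq : M * η k ^ 2 / (1 - M * η k ^ 2) < 3 := by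
        rw [div_lt_iff₀ h4]
        linarith
      have hq0 : 0 ≤ M * η k ^ 2 / (1 - M * η k ^ 2) := by positivity
      rw [key k h4]
      generalize M * η k ^ 2 / (1 - M * η k ^ 2) = q at *
      have hk : (0 : ℝ) ≤ k := Nat.cast_nonneg k
      refine ⟨sub_le_self _ (by positivity), ?_⟩
      rw [sub_pos, div_lt_iff₀ (by positivity)]
      apply mul_lt_mul_of_pos_left _ h1
      nlinarith
    intro k
    induction k with
    | zero => exact ⟨hη0pos, le_rfl, step 0 hη0pos le_rfl⟩
    | succ k ih =>
      obtain ⟨_, b, c, d⟩ := ih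
      exact ⟨d, c.trans b, step (k + 1) d (c.trans b)⟩
  refine ⟨fun k => (inv k).2.2.1, fun k => (inv k).2.1, fun h => ?_⟩
  have hlt : 2 * M * η 0 ^ 2 < 1 := by
    have h1 : 0 < Real.sqrt (2 * M) := Real.sqrt_pos.mpr (by positivity)
    rw [lt_div_iff₀ h1] at h
    have h2 : (η 0 * Real.sqrt (2 * M)) ^ 2 < 1 ^ 2 :=
      pow_lt_pow_left₀ h (by positivity) (by norm_num)
    rw [mul_pow, Real.sq_sqrt (by positivity)] at h2
    linarith
  have hanti : Antitone η := antitone_nat_of_succ_le fun k => (inv k).2.2.1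
  have hbdd : BddBelow (Set.range η) := ⟨0, by rintro _ ⟨k, rfl⟩; exact (inv k).1.le⟩
  have hC : 0 ≤ η 0 * (M * η 0 ^ 2 / (1 - M * η 0 ^ 2)) := by positivity
  have low : ∀ k : ℕ, η 0 - η 0 * (M * η 0 ^ 2 / (1 - M * η 0 ^ 2)) * (1 - 1 / ((k : ℝ) + 1)) ≤ η k := by
    intro k
    induction k with
    | zero => simp
    | succ k ih =>
      obtain ⟨h1, h2, -, -⟩ := inv k
      have h3 := mono _ h1 h2
      have h4 : 0 < 1 - M * η k ^ 2 := by linarith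
      rw [key k h4]
      have hle : η k * (M * η k ^ 2 / (1 - M * η k ^ 2)) ≤
          η 0 * (M * η 0 ^ 2 / (1 - M * η 0 ^ 2)) := by
        gcongr
      generalize η 0 * (M * η 0 ^ 2 / (1 - M * η 0 ^ 2)) = C at *
      have h5 : η k * (M * η k ^ 2 / (1 - M * η k ^ 2)) / (((k : ℝ) + 1) * ((k : ℝ) + 3)) ≤
          C / (((k : ℝ) + 1) * ((k : ℝ) + 2)) := by
        gcongr
        norm_num
      have h6 : C / (((k : ℝ) + 1) * ((k : ℝ) + 2)) =
          C * (1 - 1 / ((k : ℝ) + 1 + 1)) - C * (1 - 1 / ((k : ℝ) + 1)) := by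
        have e : (k : ℝ) + 1 + 1 = k + 2 := by ring
        rw [e]
        field_simp
        ring
      push_cast
      linarith
  have e : η 0 * (1 - 2 * M * η 0 ^ 2) / (1 - M * η 0 ^ 2) =
      η 0 - η 0 * (M * η 0 ^ 2 / (1 - M * η 0 ^ 2)) := by
    have h4 := hx0.ne'
    rw [show 2 * M * η 0 ^ 2 = 2 * (M * η 0 ^ 2) by ring]
    generalize M * η 0 ^ 2 = x at *
    field_simp
    ring
  refine ⟨_, tendsto_atTop_ciInf hanti hbdd, ?_, ?_⟩
  · refine le_ciInf fun k => le_trans ?_ (low k)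
    rw [e]
    have : (0 : ℝ) ≤ 1 / ((k : ℝ) + 1) := by positivity
    nlinarith [mul_nonneg hC this]
  · have : 0 < 1 - 2 * M * η 0 ^ 2 := by linarith
    positivity
end
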